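/- arXiv:math/9511225 — 3 statements merged into one kernel-verified Lean document; each statement's English description precedes it below -/
import Mathlib

section
/- Every convex body K in d-dimensional Euclidean space E^d admits a completely saturated packing of E^d with replicas of K. -/
open Set

noncomputable section

/-- `d`-dimensional Euclidean space. -/
abbrev Euc (d : ℕ) := EuclideanSpace ℝ (Fin d)

/-- `L` is a replica of `K`: the image of `K` under an isometry of `Euc d`. -/
def IsReplica {d : ℕ} (K L : Set (Euc d)) : Prop :=
  ∃ f : Euc d ≃ᵢ Euc d, f '' K = L

/-- A packing of `Euc d` with replicas of `K`: a family of replicas of `K`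
whose interiors are pairwise disjoint. -/
def IsPacking {d : ℕ} (K : Set (Euc d)) (P : Set (Set (Euc d))) : Prop :=
  (∀ L ∈ P, IsReplica K L) ∧
  P.Pairwise fun A B => Disjoint (interior A) (interior B)

/-- A packing `P` with replicas of `K` is `n`-saturated if one cannot delete `n - 1`
members of `P` and replace them by `n` replicas of `K` so that the result is still a
packing. -/
def IsNSaturated {d : ℕ} (K : Set (Euc d)) (P : Set (Set (Euc d))) (n : ℕ) : Prop :=
  ¬ ∃ (S : Set (Set (Euc d))) (L : Fin n → Set (Euc d)),
      S ⊆ P ∧ S.Finite ∧ S.ncard = n - 1 ∧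
      (∀ j, IsReplica K (L j)) ∧
      (∀ i j, i ≠ j → Disjoint (interior (L i)) (interior (L j))) ∧
      (∀ j, ∀ M ∈ P \ S, Disjoint (interior (L j)) (interior M))

/-- A packing is completely saturated if it is `n`-saturated for every `n ≥ 1`. -/
def IsCompletelySaturated {d : ℕ} (K : Set (Euc d)) (P : Set (Set (Euc d))) : Prop :=
  ∀ n : ℕ, 1 ≤ n → IsNSaturated K P n

open Metric Filter Topology MeasureTheory
open scoped Pointwise

/-- The images of `K` under distinct members of `G` have disjoint interiors. -/
def DisjointInteriors {E : Type*} [PseudoEMetricSpace E] (K : Set E) (G : Set (E ≃ᵢ E)) : Prop :=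
  G.Pairwise fun f g => Disjoint (interior (f '' K)) (interior (g '' K))

/-- Fewer than `n` members of the family `G` can be replaced by `n` replicas of `K`, whose
interiors are disjoint, in such a way that the copies of `s • K` in the new replicas
lie in `ball x R` and avoid all remaining members. -/
def Improvable {E : Type*} [PseudoMetricSpace E] [SMul ℝ E] (K : Set E) (G : Set (E ≃ᵢ E))
    (x : E) (R s : ℝ) : Prop :=
  ∃ (S : Finset (E ≃ᵢ E)) (n : ℕ) (f : Fin n → E ≃ᵢ E), S.card < n ∧
    (∀ i j, i ≠ j → Disjoint (interior (f i '' K)) (interior (f j '' K))) ∧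
    (∀ j, f j '' (s • K) ⊆ ball x R) ∧
    ∀ j, ∀ g ∈ G, g ∉ S → Disjoint (f j '' (s • K)) (g '' K)

theorem IsometryEquiv.interior_image {E : Type*} [PseudoEMetricSpace E] (f : E ≃ᵢ E) (K : Set E) :
    interior (f '' K) = f '' interior K :=
  (f.toHomeomorph.image_interior K).symm

section Limit

variable {E α : Type*} [MetricSpace E] {l : Filter α}

theorem tendsto_isometryEquiv_apply {h : α → E ≃ᵢ E} {f : E ≃ᵢ E} {q : α → E} {a : E}
    (hf : ∀ x, Tendsto (fun ν => h ν x) l (𝓝 (f x))) (hq : Tendsto q l (𝓝 a)) :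
    Tendsto (fun ν => h ν (q ν)) l (𝓝 (f a)) := by
  refine (hf a).congr_dist ?_
  simpa only [IsometryEquiv.dist_eq, dist_comm] using tendsto_iff_dist_tendsto_zero.1 hq

theorem tendsto_isometryEquiv_symm_apply {h : α → E ≃ᵢ E} {f : E ≃ᵢ E}
    (hf : ∀ x, Tendsto (fun ν => h ν x) l (𝓝 (f x))) (a : E) :
    Tendsto (fun ν => (h ν).symm (f a)) l (𝓝 a) := by
  rw [tendsto_iff_dist_tendsto_zero]
  refine (tendsto_iff_dist_tendsto_zero.1 (hf a)).congr fun ν => ?_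
  rw [← (h ν).dist_eq ((h ν).symm (f a)), IsometryEquiv.apply_symm_apply, dist_comm]

theorem disjoint_interior_image_of_tendsto [l.NeBot] {K : Set E} {h η : α → E ≃ᵢ E}
    {f φ : E ≃ᵢ E} (hf : ∀ x, Tendsto (fun ν => h ν x) l (𝓝 (f x)))
    (hf' : ∀ x, Tendsto (fun ν => η ν x) l (𝓝 (φ x)))
    (hd : ∀ᶠ ν in l, Disjoint (interior (h ν '' K)) (interior (η ν '' K))) :
    Disjoint (interior (f '' K)) (interior (φ '' K)) := by
  have key : ∀ {h : α → E ≃ᵢ E} {f : E ≃ᵢ E} {y : E},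
      (∀ x, Tendsto (fun ν => h ν x) l (𝓝 (f x))) → y ∈ interior (f '' K) →
      ∀ᶠ ν in l, y ∈ interior (h ν '' K) := by
    intro h f y hf hy
    rw [IsometryEquiv.interior_image] at hy
    obtain ⟨a, ha, rfl⟩ := hy
    filter_upwards [(tendsto_isometryEquiv_symm_apply hf a).eventually
      (isOpen_interior.mem_nhds ha)] with ν hν
    rw [IsometryEquiv.interior_image]
    exact ⟨_, hν, (h ν).apply_symm_apply _⟩
  rw [Set.disjoint_left]
  intro y hy hy'
  obtain ⟨ν, h1, h2, h3⟩ := (hd.and ((key hf hy).and (key hf' hy'))).exists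
  exact Set.disjoint_left.1 h1 h2 h3

theorem Ultrafilter.exists_tendsto_of_eventually_mem {𝒰 : Ultrafilter α} {A : Set E}
    (hA : IsCompact A) {q : α → E} (hq : ∀ᶠ ν in 𝒰, q ν ∈ A) :
    ∃ a ∈ A, Tendsto q 𝒰 (𝓝 a) := by
  obtain ⟨a, ha, h⟩ := hA.ultrafilter_le_nhds (𝒰.map q) (le_principal_iff.2 hq)
  exact ⟨a, ha, h⟩

theorem Ultrafilter.exists_isometryEquiv_limit [ProperSpace E] (𝒰 : Ultrafilter α)
    (h : α → E ≃ᵢ E) (x₀ : E) (R : ℝ) (hb : ∀ᶠ ν in 𝒰, dist (h ν x₀) x₀ ≤ R) :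
    ∃ f : E ≃ᵢ E, ∀ x, Tendsto (fun ν => h ν x) 𝒰 (𝓝 (f x)) := by
  have key : ∀ h : α → E ≃ᵢ E, (∀ᶠ ν in 𝒰, dist (h ν x₀) x₀ ≤ R) →
      ∃ f : E → E, ∀ x, Tendsto (fun ν => h ν x) 𝒰 (𝓝 (f x)) := by
    intro h hb
    have : ∀ x, ∃ y, Tendsto (fun ν => h ν x) 𝒰 (𝓝 y) := by
      intro x
      obtain ⟨a, -, ha⟩ := Ultrafilter.exists_tendsto_of_eventually_mem (𝒰 := 𝒰)
        (isCompact_closedBall x₀ (dist x x₀ + R)) (q := fun ν => h ν x) (by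
          filter_upwards [hb] with ν hν
          rw [mem_closedBall]
          calc dist (h ν x) x₀ ≤ dist (h ν x) (h ν x₀) + dist (h ν x₀) x₀ := dist_triangle _ _ _
            _ ≤ _ := by rw [(h ν).dist_eq]; gcongr)
      exact ⟨a, ha⟩
    exact ⟨fun x => (this x).choose, fun x => (this x).choose_spec⟩
  obtain ⟨f, hf⟩ := key h hb
  obtain ⟨g, hg⟩ := key (fun ν => (h ν).symm) (by
    filter_upwards [hb] with ν hν
    rwa [← (h ν).dist_eq, IsometryEquiv.apply_symm_apply, dist_comm])
  have hfg : ∀ x, f (g x) = x := fun x => by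
    refine tendsto_nhds_unique (hf (g x)) (tendsto_iff_dist_tendsto_zero.2 ?_)
    refine (tendsto_iff_dist_tendsto_zero.1 (hg x)).congr fun ν => ?_
    rw [← (h ν).dist_eq, IsometryEquiv.apply_symm_apply, dist_comm]
  have hgf : ∀ x, g (f x) = x := fun x => by
    refine tendsto_nhds_unique (hg (f x)) (tendsto_iff_dist_tendsto_zero.2 ?_)
    refine (tendsto_iff_dist_tendsto_zero.1 (hf x)).congr fun ν => ?_
    rw [← (h ν).dist_eq ((h ν).symm _), IsometryEquiv.apply_symm_apply, dist_comm]
  have hi : Isometry f := Isometry.of_dist_eq fun x y =>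
    tendsto_nhds_unique ((hf x).dist (hf y)) (by
      simp only [IsometryEquiv.dist_eq]
      exact tendsto_const_nhds)
  exact ⟨⟨⟨f, g, hgf, hfg⟩, hi⟩, hf⟩

end Limit

theorem exists_packing_of_not_improvable {d : ℕ} {K : Set (Euc d)} (hK : IsCompact K)
    (hint : (interior K).Nonempty) (hcl : K ⊆ closure (interior K)) (s : ℕ → ℝ)
    (hs : ∀ k, s k • K ⊆ interior K) (G : ℕ → Set (Euc d ≃ᵢ Euc d))
    (hG : ∀ ν, DisjointInteriors K (G ν))
    (hI : ∀ ν, ∀ k < ν, ¬ Improvable K (G ν) 0 (k + 1) (s k)) :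
    ∃ P : Set (Set (Euc d)), IsPacking K P ∧ IsCompletelySaturated K P := by
  classical
  let 𝒰 : Ultrafilter ℕ := hyperfilter ℕ
  let P : Set (Set (Euc d)) := {L | ∃ (f : Euc d ≃ᵢ Euc d) (h : ℕ → Euc d ≃ᵢ Euc d),
    (∀ᶠ ν in 𝒰, h ν ∈ G ν) ∧ (∀ x, Tendsto (fun ν => h ν x) 𝒰 (𝓝 (f x))) ∧ f '' K = L}
  refine ⟨P, ⟨?_, ?_⟩, ?_⟩
  · rintro L ⟨f, -, -, -, rfl⟩
    exact ⟨f, rfl⟩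
  · rintro _ ⟨f, h, hh, hf, rfl⟩ _ ⟨f', h', hh', hf', rfl⟩ hne
    refine disjoint_interior_image_of_tendsto hf hf' ?_
    have hne' : ∀ᶠ ν in 𝒰, h ν ≠ h' ν := by
      rw [Ultrafilter.eventually_not]
      intro he
      apply hne
      have : f = f' := IsometryEquiv.ext fun x => tendsto_nhds_unique (hf x)
        ((hf' x).congr' (by filter_upwards [he] with ν hν; rw [hν]))
      rw [this]
    filter_upwards [hh, hh', hne'] with ν h1 h2 h3 using hG ν h1 h2 h3
  · rintro n hn ⟨S, L, hSP, hSf, hSc, hL, hLd, hLM⟩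
    choose f hf using hL
    have hSP' : ∀ M ∈ S, ∃ (f : Euc d ≃ᵢ Euc d) (h : ℕ → Euc d ≃ᵢ Euc d),
        (∀ᶠ ν in 𝒰, h ν ∈ G ν) ∧ (∀ x, Tendsto (fun ν => h ν x) 𝒰 (𝓝 (f x))) ∧ f '' K = M :=
      fun M hM => hSP hM
    choose! F H hH hF hFK using hSP'
    obtain ⟨k, hk⟩ : ∃ k : ℕ, ∀ j, L j ⊆ ball 0 (k + 1) := by
      have hb : Bornology.IsBounded (⋃ j, L j) := by
        refine (isCompact_iUnion fun j => ?_).isBounded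
        rw [← hf]
        exact hK.image (f j).continuous
      obtain ⟨r, hr⟩ := hb.subset_ball 0
      obtain ⟨k, hk⟩ := exists_nat_gt r
      exact ⟨k, fun j => (subset_iUnion L j).trans (hr.trans (ball_subset_ball (by linarith)))⟩
    have hsub : ∀ j, f j '' (s k • K) ⊆ interior (L j) := fun j => by
      rw [← hf, IsometryEquiv.interior_image]
      exact image_mono (hs k)
    let T : ℕ → Finset (Euc d ≃ᵢ Euc d) := fun ν => hSf.toFinset.image fun M => H M ν
    have main : ∀ j, ∀ᶠ ν in 𝒰, ∀ g ∈ G ν, g ∉ T ν → Disjoint (f j '' (s k • K)) (g '' K) := by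
      intro j
      by_contra hcon
      rw [← Ultrafilter.eventually_not] at hcon
      have : ∀ ν, ∃ g q, (¬ ∀ g ∈ G ν, g ∉ T ν → Disjoint (f j '' (s k • K)) (g '' K)) →
          g ∈ G ν ∧ g ∉ T ν ∧ q ∈ K ∧ g q ∈ f j '' (s k • K) := by
        intro ν
        by_cases hc : ∀ g ∈ G ν, g ∉ T ν → Disjoint (f j '' (s k • K)) (g '' K)
        · exact ⟨IsometryEquiv.refl _, 0, fun h => absurd hc h⟩
        · have hc' := hc
          push Not at hc'
          obtain ⟨g, hg, hgT, hnd⟩ := hc'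
          obtain ⟨_, hy, q, hq, rfl⟩ := Set.not_disjoint_iff.1 hnd
          exact ⟨g, q, fun _ => ⟨hg, hgT, hq, hy⟩⟩
      choose h q hhq using this
      have hev := hcon.mono fun ν => hhq ν
      have hcs : IsCompact (f j '' (s k • K)) := (hK.smul (s k)).image (f j).continuous
      obtain ⟨a, ha, hqa⟩ := Ultrafilter.exists_tendsto_of_eventually_mem hK
        (hev.mono fun ν hν => hν.2.2.1)
      obtain ⟨p, hp, hqp⟩ := Ultrafilter.exists_tendsto_of_eventually_mem hcs
        (hev.mono fun ν hν => hν.2.2.2)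
      obtain ⟨r, hr⟩ := hcs.isBounded.subset_closedBall a
      obtain ⟨r', hr'⟩ := hK.isBounded.subset_closedBall a
      obtain ⟨φ, hφ⟩ := 𝒰.exists_isometryEquiv_limit h a (r' + r) (by
        filter_upwards [hev] with ν hν
        calc dist (h ν a) a ≤ dist (h ν a) (h ν (q ν)) + dist (h ν (q ν)) a := dist_triangle _ _ _
          _ ≤ r' + r := by
            rw [(h ν).dist_eq, dist_comm]
            exact add_le_add (hr' hν.2.2.1) (hr hν.2.2.2))
      have hpa : p = φ a := tendsto_nhds_unique hqp (tendsto_isometryEquiv_apply hφ hqa)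
      have hφP : φ '' K ∈ P := ⟨φ, h, hev.mono fun ν hν => hν.1, hφ, rfl⟩
      by_cases hφS : φ '' K ∈ S
      · have hdis := disjoint_interior_image_of_tendsto (K := K) hφ (hF _ hφS) (by
          filter_upwards [hev, hH _ hφS] with ν hν hν'
          refine hG ν hν.1 hν' fun he => hν.2.1 ?_
          rw [he]
          exact Finset.mem_image_of_mem _ (hSf.mem_toFinset.2 hφS))
        rw [hFK _ hφS, disjoint_self, IsometryEquiv.interior_image] at hdis
        exact (hint.image φ).ne_empty hdis
      · have hdis := hLM j _ ⟨hφP, hφS⟩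
        have hpc : p ∈ closure (interior (φ '' K)) := by
          rw [IsometryEquiv.interior_image, hpa]
          exact image_closure_subset_closure_image φ.continuous ⟨a, hcl ha, rfl⟩
        exact Set.disjoint_left.1 (hdis.closure_right isOpen_interior) (hsub j hp) hpc
    have hgt : ∀ᶠ ν in 𝒰, k < ν :=
      (Nat.hyperfilter_le_atTop : (𝒰 : Filter ℕ) ≤ atTop) (eventually_gt_atTop k)
    obtain ⟨ν, hν, hkν⟩ := ((eventually_all.2 main).and hgt).exists
    refine hI ν k hkν ⟨T ν, n, f, ?_, ?_, ?_, hν⟩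
    · calc (T ν).card ≤ hSf.toFinset.card := Finset.card_image_le
        _ = S.ncard := (Set.ncard_eq_toFinset_card S hSf).symm
        _ < n := by omega
    · intro i j hij
      rw [hf, hf]
      exact hLd i j hij
    · exact fun j => (hsub j).trans (interior_subset.trans (hk j))

theorem volume_real_ball_euc {d : ℕ} (x : Euc d) {r : ℝ} (hr : 0 < r) :
    volume.real (ball x r) = r ^ d * volume.real (ball (0 : Euc d) 1) := by
  rw [measureReal_def, Measure.addHaar_ball_of_pos _ _ hr, ENNReal.toReal_mul,
    ENNReal.toReal_ofReal (by positivity), finrank_euclideanSpace_fin, measureReal_def]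

/-- The largest number of replicas of `K` with disjoint interiors contained in `ball 0 N`. -/
def packingNumber {d : ℕ} (K : Set (Euc d)) (N : ℝ) : ℕ :=
  sSup {m | ∃ G : Finset (Euc d ≃ᵢ Euc d), G.card = m ∧
    DisjointInteriors K (G : Set (Euc d ≃ᵢ Euc d)) ∧ ∀ g ∈ G, g '' K ⊆ ball 0 N}

section PackingNumber

variable {d : ℕ} {K : Set (Euc d)} {r : ℝ}

theorem card_mul_pow_le (hr : 0 < r) (hrK : ball 0 r ⊆ K) {N : ℝ} (hN : 0 < N)
    {G : Finset (Euc d ≃ᵢ Euc d)} (hG : DisjointInteriors K (G : Set (Euc d ≃ᵢ Euc d)))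
    (hGN : ∀ g ∈ G, g '' K ⊆ ball 0 N) : G.card * r ^ d ≤ N ^ d := by
  have hω : 0 < volume.real (ball (0 : Euc d) 1) :=
    ENNReal.toReal_pos (measure_ball_pos _ _ one_pos).ne' measure_ball_lt_top.ne
  have hball : ∀ g : Euc d ≃ᵢ Euc d, ball (g 0) r ⊆ interior (g '' K) := fun g => by
    refine interior_maximal ?_ isOpen_ball
    rw [← g.image_ball]
    exact image_mono hrK
  have h1 : volume.real (⋃ g ∈ G, ball (g 0) r) =
      G.card * (r ^ d * volume.real (ball (0 : Euc d) 1)) := by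
    rw [measureReal_biUnion_finset (fun g hg g' hg' hne => (hG hg hg' hne).mono (hball g) (hball g'))
      (fun _ _ => measurableSet_ball) (fun _ _ => measure_ball_lt_top.ne)]
    simp [volume_real_ball_euc _ hr]
  have h2 : volume.real (⋃ g ∈ G, ball (g 0) r) ≤ volume.real (ball (0 : Euc d) N) :=
    measureReal_mono (iUnion₂_subset fun g hg => (hball g).trans (interior_subset.trans (hGN g hg)))
      measure_ball_lt_top.ne
  rw [h1, volume_real_ball_euc _ hN, ← mul_assoc] at h2
  simpa using le_of_mul_le_mul_right h2 hω

theorem bddAbove_card_packing (hr : 0 < r) (hrK : ball 0 r ⊆ K) {N : ℝ} (hN : 0 < N) :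
    BddAbove {m | ∃ G : Finset (Euc d ≃ᵢ Euc d), G.card = m ∧
      DisjointInteriors K (G : Set (Euc d ≃ᵢ Euc d)) ∧ ∀ g ∈ G, g '' K ⊆ ball 0 N} := by
  obtain ⟨b, hb⟩ := exists_nat_ge (N ^ d / r ^ d)
  refine ⟨b, ?_⟩
  rintro _ ⟨G, rfl, hG, hGN⟩
  have := card_mul_pow_le hr hrK hN hG hGN
  rw [← le_div_iff₀ (by positivity)] at this
  exact_mod_cast this.trans hb

theorem exists_card_eq_packingNumber (hr : 0 < r) (hrK : ball 0 r ⊆ K) {N : ℝ} (hN : 0 < N) :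
    ∃ G : Finset (Euc d ≃ᵢ Euc d), G.card = packingNumber K N ∧
      DisjointInteriors K (G : Set (Euc d ≃ᵢ Euc d)) ∧ ∀ g ∈ G, g '' K ⊆ ball 0 N :=
  Nat.sSup_mem (s := {m | ∃ G : Finset (Euc d ≃ᵢ Euc d), G.card = m ∧
    DisjointInteriors K (G : Set (Euc d ≃ᵢ Euc d)) ∧ ∀ g ∈ G, g '' K ⊆ ball 0 N})
    ⟨0, ∅, by simp [DisjointInteriors]⟩ (bddAbove_card_packing hr hrK hN)

theorem packingNumber_mul_pow_le (hr : 0 < r) (hrK : ball 0 r ⊆ K) {N : ℝ} (hN : 0 < N) :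
    packingNumber K N * r ^ d ≤ N ^ d := by
  obtain ⟨G, hc, hG, hGN⟩ := exists_card_eq_packingNumber hr hrK hN
  rw [← hc]
  exact card_mul_pow_le hr hrK hN hG hGN

theorem card_le_packingNumber (hr : 0 < r) (hrK : ball 0 r ⊆ K) {N : ℝ} (hN : 0 < N)
    {ι : Type*} [Fintype ι] (f : ι → Euc d ≃ᵢ Euc d)
    (hf : Pairwise fun i j => Disjoint (interior (f i '' K)) (interior (f j '' K)))
    (hfN : ∀ i, f i '' K ⊆ ball 0 N) : Fintype.card ι ≤ packingNumber K N := by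
  classical
  have hne : (interior K).Nonempty := ⟨0, interior_maximal hrK isOpen_ball (mem_ball_self hr)⟩
  have hinj : Function.Injective f := by
    intro i j hij
    by_contra h
    have := hf h
    simp only [hij, disjoint_self, IsometryEquiv.interior_image] at this
    exact (hne.image _).ne_empty this
  refine le_csSup (bddAbove_card_packing hr hrK hN) ⟨Finset.univ.image f, ?_, ?_, ?_⟩
  · rw [Finset.card_image_of_injective _ hinj, Finset.card_univ]
  · intro g hg g' hg' hne
    simp only [Finset.coe_image, Finset.coe_univ, image_univ, mem_range] at hg hg'
    obtain ⟨i, rfl⟩ := hg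
    obtain ⟨j, rfl⟩ := hg'
    exact hf fun h => hne (by rw [h])
  · simpa using hfN

/-- The conjugate of an isometry by the dilation of ratio `s`. -/
def IsometryEquiv.conjDilation (f : Euc d ≃ᵢ Euc d) {s : ℝ} (hs : s ≠ 0) : Euc d ≃ᵢ Euc d where
  toFun x := s⁻¹ • f (s • x)
  invFun x := s⁻¹ • f.symm (s • x)
  left_inv x := by simp [smul_smul, hs]
  right_inv x := by simp [smul_smul, hs]
  isometry_toFun := Isometry.of_dist_eq fun x y => by
    rw [dist_smul₀, f.dist_eq, dist_smul₀, ← mul_assoc, ← norm_mul, inv_mul_cancel₀ hs, norm_one,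
      one_mul]

theorem IsometryEquiv.conjDilation_image (f : Euc d ≃ᵢ Euc d) {s : ℝ} (hs : s ≠ 0)
    (K : Set (Euc d)) :
    f.conjDilation hs '' K = s⁻¹ • (f '' (s • K)) := by
  simp only [← image_smul, image_image]
  rfl

theorem card_le_packingNumber_div (hr : 0 < r) (hrK : ball 0 r ⊆ K) {N s : ℝ} (hN : 0 < N)
    (hs : 0 < s) {ι : Type*} [Fintype ι] (f : ι → Euc d ≃ᵢ Euc d)
    (hf : Pairwise fun i j => Disjoint (interior (f i '' (s • K))) (interior (f j '' (s • K))))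
    (hfN : ∀ i, f i '' (s • K) ⊆ ball 0 N) : Fintype.card ι ≤ packingNumber K (N / s) := by
  refine card_le_packingNumber hr hrK (by positivity) (fun i => (f i).conjDilation hs.ne') ?_ ?_
  · intro i j hij
    simp only [IsometryEquiv.conjDilation_image]
    rw [interior_smul₀ (inv_ne_zero hs.ne'), interior_smul₀ (inv_ne_zero hs.ne'),
      ← image_smul, ← image_smul]
    exact (disjoint_image_iff (smul_right_injective _ (inv_ne_zero hs.ne'))).2 (hf hij)
  · intro i
    rw [IsometryEquiv.conjDilation_image]
    refine (smul_set_mono (hfN i)).trans ?_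
    rw [_root_.smul_ball (inv_ne_zero hs.ne'), smul_zero, norm_inv, Real.norm_of_nonneg hs.le,
      div_eq_inv_mul]

theorem card_add_card_le_packingNumber (hr : 0 < r) (hrK : ball 0 r ⊆ K) {N s R : ℝ} (hN : 0 < N)
    (hs : 0 < s) (hsK : s • K ⊆ K) {G : Finset (Euc d ≃ᵢ Euc d)}
    (hG : DisjointInteriors K (G : Set (Euc d ≃ᵢ Euc d))) (hGN : ∀ g ∈ G, g '' K ⊆ ball 0 N)
    (X : Finset (Euc d))
    (hX : ∀ x ∈ X, Improvable K (G : Set (Euc d ≃ᵢ Euc d)) x R s ∧ ball x R ⊆ ball 0 N)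
    (hXd : ∀ x ∈ X, ∀ y ∈ X, x ≠ y → 2 * R ≤ dist x y) :
    G.card + X.card ≤ packingNumber K (N / s) := by
  classical
  have hX' := fun x : X => (hX x x.2).1
  choose S n f hSn hfd hfR hfG using hX'
  let D := Finset.univ.biUnion S
  let F : (↥(G \ D) ⊕ Σ x : X, Fin (n x)) → Euc d ≃ᵢ Euc d :=
    Sum.elim (fun g => g) (fun p => f p.1 p.2)
  have hi : ∀ g : Euc d ≃ᵢ Euc d, interior (g '' (s • K)) ⊆ interior (g '' K) := fun g =>
    interior_mono (image_mono hsK)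
  have hold : ∀ (g : ↥(G \ D)) (p : Σ x : X, Fin (n x)),
      Disjoint (interior (f p.1 p.2 '' (s • K))) (interior (g.1 '' (s • K))) := by
    rintro ⟨g, hg⟩ ⟨x, j⟩
    rw [Finset.mem_sdiff] at hg
    refine (hfG x j g hg.1 fun h => hg.2 ?_).mono interior_subset
      (interior_subset.trans (image_mono hsK))
    exact Finset.mem_biUnion.2 ⟨x, Finset.mem_univ _, h⟩
  have hcard := card_le_packingNumber_div hr hrK hN hs F ?_ ?_
  · rw [Fintype.card_sum, Fintype.card_sigma, Fintype.card_coe] at hcard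
    simp only [Fintype.card_fin] at hcard
    have h1 : D.card ≤ ∑ x, (S x).card := Finset.card_biUnion_le
    have h2 : ∑ x : X, ((S x).card + 1) ≤ ∑ x, n x := Finset.sum_le_sum fun x _ => hSn x
    have h3 := Finset.le_card_sdiff D G
    rw [Finset.sum_add_distrib] at h2
    simp only [Finset.sum_const, Finset.card_univ, Fintype.card_coe, smul_eq_mul, mul_one] at h2
    omega
  · rintro (g | ⟨x, j⟩) (g' | ⟨y, j'⟩) hne
    · refine (hG (Finset.mem_sdiff.1 g.2).1 (Finset.mem_sdiff.1 g'.2).1 ?_).mono (hi _) (hi _)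
      exact fun h => hne (congrArg Sum.inl (Subtype.ext h))
    · exact (hold g ⟨y, j'⟩).symm
    · exact hold g' ⟨x, j⟩
    · by_cases hxy : x = y
      · subst hxy
        refine (hfd x j j' fun h => hne (by rw [h])).mono (hi _) (hi _)
      · refine (ball_disjoint_ball ?_).mono (interior_subset.trans (hfR x j))
          (interior_subset.trans (hfR y j'))
        have := hXd x x.2 y y.2 (fun h => hxy (Subtype.ext h))
        linarith
  · rintro (g | ⟨x, j⟩)
    · exact (image_mono hsK).trans (hGN _ (Finset.mem_sdiff.1 g.2).1)
    · exact (hfR x j).trans (hX x x.2).2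

end PackingNumber

theorem exists_forall_ge_le_add {a : ℝ → ℝ} {C N₀ ε : ℝ} (h₀ : ∀ N, N₀ ≤ N → 0 ≤ a N)
    (hC : ∀ N, N₀ ≤ N → a N ≤ C) (hε : 0 < ε) :
    ∃ N, N₀ ≤ N ∧ ∀ N', N ≤ N' → a N' ≤ a N + ε := by
  let T : Set ℝ := {t | ∃ N₁, N₀ ≤ N₁ ∧ ∀ N, N₁ ≤ N → a N ≤ t}
  have hTne : T.Nonempty := ⟨C, N₀, le_rfl, hC⟩
  have hTb : BddBelow T := ⟨0, by
    rintro t ⟨N₁, h1, h2⟩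
    exact (h₀ N₁ h1).trans (h2 N₁ le_rfl)⟩
  obtain ⟨t, ⟨N₁, hN₁, ht⟩, htΔ⟩ := exists_lt_of_csInf_lt hTne
    (show sInf T < sInf T + ε / 2 by linarith)
  have hnot : sInf T - ε / 2 ∉ T := fun h => by
    have := csInf_le hTb h
    linarith
  have : ∃ N, N₁ ≤ N ∧ sInf T - ε / 2 < a N := by
    by_contra! h
    exact hnot ⟨N₁, hN₁, h⟩
  obtain ⟨N, hN, hlt⟩ := this
  refine ⟨N, hN₁.trans hN, fun N' hN' => ?_⟩
  have := ht N' (hN.trans hN')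
  linarith

theorem exists_separated_finset_cover {E : Type*} [MetricSpace E] {A : Set E} {δ : ℝ}
    (hδ : 0 < δ) {b : ℕ} (hb : ∀ X : Finset E, (∀ x ∈ X, x ∈ A) →
      (∀ x ∈ X, ∀ y ∈ X, x ≠ y → δ ≤ dist x y) → X.card ≤ b) :
    ∃ X : Finset E, (∀ x ∈ X, x ∈ A) ∧ (∀ x ∈ X, ∀ y ∈ X, x ≠ y → δ ≤ dist x y) ∧
      ∀ y ∈ A, ∃ x ∈ X, dist y x < δ := by
  classical
  let T : Set ℕ := {m | ∃ X : Finset E, X.card = m ∧ (∀ x ∈ X, x ∈ A) ∧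
    ∀ x ∈ X, ∀ y ∈ X, x ≠ y → δ ≤ dist x y}
  have hTb : BddAbove T := ⟨b, by
    rintro _ ⟨X, rfl, h1, h2⟩
    exact hb X h1 h2⟩
  obtain ⟨X, hXc, hXA, hXd⟩ : sSup T ∈ T := Nat.sSup_mem ⟨0, ∅, by simp⟩ hTb
  refine ⟨X, hXA, hXd, fun y hy => ?_⟩
  by_contra! h
  have hyX : y ∉ X := fun hyX => by
    have := h y hyX
    rw [dist_self] at this
    linarith
  have hmem : X.card + 1 ∈ T := by
    refine ⟨insert y X, Finset.card_insert_of_notMem hyX, ?_, ?_⟩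
    · rw [Finset.forall_mem_insert]
      exact ⟨hy, hXA⟩
    · intro x hx z hz hxz
      rw [Finset.mem_insert] at hx hz
      rcases hx with rfl | hx <;> rcases hz with rfl | hz
      · exact absurd rfl hxz
      · exact h z hz
      · rw [dist_comm]
        exact h x hx
      · exact hXd x hx z hz hxz
  have := le_csSup hTb hmem
  omega

/-- The proportion of centers `x` at which improvability inside `ball x (k + 1)` is tolerated. -/
def toleratedDensity (d k : ℕ) : ℝ := (1 / 2) ^ (k + 2) / (2 * (k + 1)) ^ d

theorem toleratedDensity_pos (d k : ℕ) : 0 < toleratedDensity d k := by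
  unfold toleratedDensity
  positivity

theorem sum_toleratedDensity_lt (d n : ℕ) :
    ∑ k ∈ Finset.range n, toleratedDensity d k * (2 * (k + 1)) ^ d < 1 / 2 := by
  have h : ∑ k ∈ Finset.range n, toleratedDensity d k * (2 * (k + 1)) ^ d
      = 1 / 2 - (1 / 2) ^ (n + 1) := by
    induction n with
    | zero => norm_num
    | succ n ih =>
      rw [Finset.sum_range_succ, ih, toleratedDensity, div_mul_cancel₀ _ (by positivity)]
      ring
  rw [h]
  have : (0 : ℝ) < (1 / 2) ^ (n + 1) := by positivity
  linarith

theorem volume_real_biUnion_ball_le {d n : ℕ} {N : ℝ} (X : ℕ → Finset (Euc d))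
    (hX : ∀ k < n, (X k).card ≤ toleratedDensity d k * N ^ d) :
    volume.real (⋃ k ∈ Finset.range n, ⋃ x ∈ X k, ball x (2 * ((k : ℝ) + 1))) ≤
      (∑ k ∈ Finset.range n, toleratedDensity d k * (2 * (k + 1)) ^ d) * N ^ d *
        volume.real (ball (0 : Euc d) 1) := by
  calc _ ≤ ∑ k ∈ Finset.range n, volume.real (⋃ x ∈ X k, ball x (2 * ((k : ℝ) + 1))) :=
        measureReal_biUnion_finset_le _ _
    _ ≤ ∑ k ∈ Finset.range n, (toleratedDensity d k * N ^ d) *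
        ((2 * ((k : ℝ) + 1)) ^ d * volume.real (ball (0 : Euc d) 1)) := by
        refine Finset.sum_le_sum fun k hk => ?_
        calc _ ≤ ∑ x ∈ X k, volume.real (ball x (2 * ((k : ℝ) + 1))) :=
              measureReal_biUnion_finset_le _ _
          _ = (X k).card * ((2 * ((k : ℝ) + 1)) ^ d * volume.real (ball (0 : Euc d) 1)) := by
              rw [← nsmul_eq_mul, ← Finset.sum_const]
              exact Finset.sum_congr rfl fun x _ => volume_real_ball_euc _ (by positivity)
          _ ≤ _ := mul_le_mul_of_nonneg_right (hX k (Finset.mem_range.1 hk))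
              (mul_nonneg (by positivity) measureReal_nonneg)
    _ = _ := by
        simp only [Finset.sum_mul]
        exact Finset.sum_congr rfl fun k _ => by ring

theorem exists_not_improvable {d : ℕ} {K : Set (Euc d)} {r : ℝ} (hr : 0 < r)
    (hrK : ball 0 r ⊆ K) {s : ℕ → ℝ} (hs : ∀ k, 0 < s k) (hs1 : ∀ k, s k ≤ 1)
    (hsK : ∀ k, s k • K ⊆ K)
    (hsd : ∀ k, 1 / r ^ d * (1 / s k ^ d - 1) ≤ toleratedDensity d k / 2) (n : ℕ) :
    ∃ (G : Set (Euc d ≃ᵢ Euc d)) (x : Euc d), DisjointInteriors K G ∧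
      ∀ k < n, ¬ Improvable K G x (k + 1) (s k) := by
  obtain ⟨ε, hε, hεs⟩ : ∃ ε : ℝ, 0 < ε ∧ ∀ k ∈ Finset.range n,
      ε ≤ toleratedDensity d k / 2 * s k ^ d := by
    have : ∀ᶠ ε in 𝓝[>] (0 : ℝ), ∀ k ∈ Finset.range n, ε ≤ toleratedDensity d k / 2 * s k ^ d :=
      (Filter.eventually_all_finset _).2 fun k _ => by
        have := toleratedDensity_pos d k
        have := hs k
        exact nhdsWithin_le_nhds (Iic_mem_nhds (by positivity))
    obtain ⟨ε, h1, h2⟩ := (this.and self_mem_nhdsWithin).exists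
    exact ⟨ε, h2, h1⟩
  obtain ⟨N₀, hN₀⟩ : ∃ N₀ : ℝ, ∀ N, N₀ ≤ N → 0 < N ∧ n < N ∧ 1 / 2 * N ^ d ≤ (N - n) ^ d := by
    have ht : Tendsto (fun N : ℝ => (1 - n * N⁻¹) ^ d) atTop (𝓝 ((1 - n * 0) ^ d)) :=
      ((tendsto_inv_atTop_zero.const_mul _).const_sub _).pow _
    have h1 := ht.eventually (lt_mem_nhds (show (1 / 2 : ℝ) < (1 - n * 0) ^ d by norm_num))
    obtain ⟨N₀, hN₀⟩ := eventually_atTop.1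
      (h1.and ((eventually_gt_atTop (0 : ℝ)).and (eventually_gt_atTop (n : ℝ))))
    refine ⟨N₀, fun N hN => ?_⟩
    obtain ⟨h2, h3, h4⟩ := hN₀ N hN
    refine ⟨h3, h4, ?_⟩
    calc 1 / 2 * N ^ d ≤ (1 - n * N⁻¹) ^ d * N ^ d := by gcongr
      _ = (N - n) ^ d := by
        rw [← mul_pow, sub_mul, mul_assoc, inv_mul_cancel₀ h3.ne', one_mul, mul_one]
  have hpN : ∀ N, 0 < N → (packingNumber K N : ℝ) / N ^ d ≤ 1 / r ^ d := fun N hN => by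
    rw [div_le_div_iff₀ (by positivity) (by positivity), one_mul]
    exact packingNumber_mul_pow_le hr hrK hN
  obtain ⟨N, hN, hNmax⟩ := exists_forall_ge_le_add (a := fun N => (packingNumber K N : ℝ) / N ^ d)
    (C := 1 / r ^ d) (N₀ := N₀) (ε := ε) (fun N hN => by have := (hN₀ N hN).1; positivity)
    (fun N hN => hpN N (hN₀ N hN).1) hε
  obtain ⟨hN0, hnN, hNd⟩ := hN₀ N hN
  obtain ⟨G, hGc, hG, hGN⟩ := exists_card_eq_packingNumber hr hrK hN0
  by_contra! hcon
  have hbad : ∀ x, ∃ k < n, Improvable K (G : Set (Euc d ≃ᵢ Euc d)) x (k + 1) (s k) :=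
    fun x => hcon G x hG
  have hcard : ∀ k < n, ∀ X : Finset (Euc d),
      (∀ x ∈ X, x ∈ {x | Improvable K (G : Set (Euc d ≃ᵢ Euc d)) x (k + 1) (s k)} ∩
        ball 0 (N - n)) →
      (∀ x ∈ X, ∀ y ∈ X, x ≠ y → 2 * ((k : ℝ) + 1) ≤ dist x y) →
      X.card ≤ toleratedDensity d k * N ^ d := by
    intro k hk X hX hXd
    have hkn : (k : ℝ) + 1 ≤ n := by exact_mod_cast hk
    have h1 := card_add_card_le_packingNumber hr hrK hN0 (hs k) (hsK k) hG hGN X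
      (fun x hx => ⟨(hX x hx).1, ball_subset_ball' (by
        have := mem_ball.1 (hX x hx).2
        linarith)⟩) hXd
    have hsk := hs k
    have hle : N ≤ N / s k := le_div_self hN0.le hsk (hs1 k)
    have h2 := hNmax _ hle
    have h3 := hεs k (Finset.mem_range.2 hk)
    have h4 := hsd k
    have h5 := hpN N hN0
    rw [hGc] at h1
    have h1' : (packingNumber K N : ℝ) + X.card ≤ packingNumber K (N / s k) := by exact_mod_cast h1
    set p : ℝ := packingNumber K N / N ^ d with hp
    have hpe : (packingNumber K N : ℝ) = p * N ^ d := by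
      rw [hp, div_mul_cancel₀ _ (by positivity)]
    rw [div_le_iff₀ (by positivity), div_pow] at h2
    rw [← div_le_iff₀ (by positivity)] at h3
    have h6 : p * (1 / s k ^ d - 1) ≤ toleratedDensity d k / 2 :=
      (mul_le_mul_of_nonneg_right h5 (by
        rw [sub_nonneg]
        exact one_le_one_div (by positivity) (pow_le_one₀ hsk.le (hs1 k)))).trans h4
    calc (X.card : ℝ) ≤ (p + ε) * (N ^ d / s k ^ d) - p * N ^ d := by linarith
      _ = (p * (1 / s k ^ d - 1) + ε / s k ^ d) * N ^ d := by ring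
      _ ≤ (toleratedDensity d k / 2 + toleratedDensity d k / 2) * N ^ d := by gcongr
      _ = _ := by ring
  have hcover : ∀ k : ℕ, ∃ X : Finset (Euc d), k < n →
      X.card ≤ toleratedDensity d k * N ^ d ∧
      {x | Improvable K (G : Set (Euc d ≃ᵢ Euc d)) x (k + 1) (s k)} ∩ ball 0 (N - n) ⊆
        ⋃ x ∈ X, ball x (2 * (k + 1)) := by
    intro k
    by_cases hk : k < n
    · obtain ⟨b, hb⟩ := exists_nat_ge (toleratedDensity d k * N ^ d)
      obtain ⟨X, hXA, hXd, hXc⟩ := exists_separated_finset_cover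
        (δ := 2 * ((k : ℝ) + 1)) (b := b) (by positivity)
        fun X h1 h2 => by exact_mod_cast (hcard k hk X h1 h2).trans hb
      refine ⟨X, fun _ => ⟨hcard k hk X hXA hXd, fun y hy => ?_⟩⟩
      simpa using hXc y hy
    · exact ⟨∅, fun h => absurd h hk⟩
  choose X hX using hcover
  have hω : 0 < volume.real (ball (0 : Euc d) 1) :=
    ENNReal.toReal_pos (measure_ball_pos _ _ one_pos).ne' measure_ball_lt_top.ne
  have hvol : volume.real (ball (0 : Euc d) (N - n)) ≤
      volume.real (⋃ k ∈ Finset.range n, ⋃ x ∈ X k, ball x (2 * ((k : ℝ) + 1))) := by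
    refine measureReal_mono ?_ ?_
    · intro x hx
      obtain ⟨k, hk, hxk⟩ := hbad x
      exact mem_iUnion₂.2 ⟨k, Finset.mem_range.2 hk, (hX k hk).2 ⟨hxk, hx⟩⟩
    · exact ((measure_biUnion_lt_top (Finset.finite_toSet _) fun k _ =>
        measure_biUnion_lt_top (Finset.finite_toSet _) fun x _ => measure_ball_lt_top)).ne
  rw [volume_real_ball_euc _ (by linarith)] at hvol
  have hle := volume_real_biUnion_ball_le X fun k hk => (hX k hk).1
  have hlt := mul_lt_mul_of_pos_right
    (mul_lt_mul_of_pos_right (sum_toleratedDensity_lt d n) (pow_pos hN0 d)) hω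
  have := mul_le_mul_of_nonneg_right hNd hω.le
  linarith

theorem Improvable.translate {E : Type*} [NormedAddCommGroup E] [NormedSpace ℝ E] {K : Set E}
    {G : Set (E ≃ᵢ E)} {x y : E} {R s : ℝ}
    (h : Improvable K ((fun g => g.trans (IsometryEquiv.addRight y)) '' G) (x + y) R s) :
    Improvable K G x R s := by
  classical
  obtain ⟨S, n, f, hSn, hfd, hfR, hfG⟩ := h
  let τ := IsometryEquiv.addRight y
  have himg : ∀ (g : E ≃ᵢ E) (A : Set E), g.trans τ '' A = τ '' (g '' A) := fun g A => by
    rw [image_image]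
    rfl
  have himg' : ∀ (g : E ≃ᵢ E) (A : Set E), τ '' (g.trans τ.symm '' A) = g '' A := fun g A => by
    rw [← himg]
    congr 1
    ext z
    simp [τ]
  refine ⟨S.image fun g => g.trans τ.symm, n, fun j => (f j).trans τ.symm,
    Finset.card_image_le.trans_lt hSn, fun i j hij => ?_, fun j => ?_, fun j g hg hgS => ?_⟩
  · rw [← disjoint_image_iff τ.injective, ← IsometryEquiv.interior_image,
      ← IsometryEquiv.interior_image, himg', himg']
    exact hfd i j hij
  · rw [← image_subset_image_iff τ.injective, himg', τ.image_ball]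
    exact hfR j
  · rw [← disjoint_image_iff τ.injective, himg', ← himg]
    refine hfG j _ ⟨g, hg, rfl⟩ fun hmem => hgS ?_
    refine Finset.mem_image.2 ⟨_, hmem, ?_⟩
    ext z
    simp [τ]

theorem exists_ratio_le {d : ℕ} {r η : ℝ} (hη : 0 < η) :
    ∃ s : ℝ, 0 < s ∧ s < 1 ∧ 1 / r ^ d * (1 / s ^ d - 1) ≤ η := by
  have hc : ContinuousAt (fun s : ℝ => 1 / r ^ d * (1 / s ^ d - 1)) 1 := by
    refine ContinuousAt.mul continuousAt_const (ContinuousAt.sub (ContinuousAt.div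
      continuousAt_const (continuousAt_id.pow d) (by simp)) continuousAt_const)
  have h1 : ∀ᶠ s in 𝓝[<] (1 : ℝ), 1 / r ^ d * (1 / s ^ d - 1) ≤ η :=
    nhdsWithin_le_nhds (hc.eventually (Iic_mem_nhds (by simpa using hη)))
  have h2 : ∀ᶠ s in 𝓝[<] (1 : ℝ), 0 < s := nhdsWithin_le_nhds (Ioi_mem_nhds one_pos)
  obtain ⟨s, h1, h2, h3⟩ := (h1.and (h2.and self_mem_nhdsWithin)).exists
  exact ⟨s, h2, h3, h1⟩

theorem Convex.smul_subset_interior {E : Type*} [NormedAddCommGroup E] [NormedSpace ℝ E]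
    {K : Set E} (hK : Convex ℝ K) (h0 : (0 : E) ∈ interior K) {s : ℝ} (hs : 0 < s) (hs1 : s < 1) :
    s • K ⊆ interior K := by
  rintro _ ⟨x, hx, rfl⟩
  have := hK.combo_interior_self_subset_interior (a := 1 - s) (b := s) (by linarith) hs.le (by ring)
  refine this ?_
  simpa using Set.add_mem_add (Set.smul_mem_smul_set (a := 1 - s) h0)
    (Set.smul_mem_smul_set (a := s) hx)

theorem exists_completely_saturated_packing_of_zero_mem_interior {d : ℕ} {K : Set (Euc d)}
    (hKcpt : IsCompact K) (hKconv : Convex ℝ K) (h0 : (0 : Euc d) ∈ interior K) :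
    ∃ P : Set (Set (Euc d)), IsPacking K P ∧ IsCompletelySaturated K P := by
  obtain ⟨r, hr, hrK⟩ := Metric.mem_nhds_iff.1 (mem_interior_iff_mem_nhds.1 h0)
  choose s hs hs1 hsd using fun k =>
    exists_ratio_le (d := d) (r := r) (half_pos (toleratedDensity_pos d k))
  have hsK : ∀ k, s k • K ⊆ interior K := fun k => hKconv.smul_subset_interior h0 (hs k) (hs1 k)
  choose G x hG hI using exists_not_improvable hr hrK hs (fun k => (hs1 k).le)
    (fun k => (hsK k).trans interior_subset) hsd
  have hcl : K ⊆ closure (interior K) := by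
    rw [hKconv.closure_interior_eq_closure_of_nonempty_interior ⟨0, h0⟩]
    exact subset_closure
  refine exists_packing_of_not_improvable hKcpt ⟨0, h0⟩ hcl s hsK
    (fun n => (fun g => g.trans (IsometryEquiv.addRight (-x n))) '' G n) ?_ ?_
  · rintro n _ ⟨g, hg, rfl⟩ _ ⟨g', hg', rfl⟩ hne
    have himg : ∀ g : Euc d ≃ᵢ Euc d, g.trans (IsometryEquiv.addRight (-x n)) '' K =
        IsometryEquiv.addRight (-x n) '' (g '' K) := fun g => by
      rw [image_image]
      rfl
    simp only [himg]
    rw [IsometryEquiv.interior_image (IsometryEquiv.addRight (-x n)),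
      IsometryEquiv.interior_image (IsometryEquiv.addRight (-x n)),
      disjoint_image_iff (IsometryEquiv.injective _)]
    exact hG n hg hg' fun h => hne (by rw [h])
  · intro n k hk h
    rw [← add_neg_cancel (x n)] at h
    exact hI n k hk h.translate

theorem isReplica_image_iff {d : ℕ} (e : Euc d ≃ᵢ Euc d) {K L : Set (Euc d)} :
    IsReplica (e '' K) L ↔ IsReplica K L := by
  constructor
  · rintro ⟨f, rfl⟩
    exact ⟨e.trans f, by rw [image_image]; rfl⟩
  · rintro ⟨f, rfl⟩
    exact ⟨e.symm.trans f, by rw [image_image]; simp⟩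

/-- Every convex body `K` in `Euc d` admits a completely saturated packing of `Euc d`
with replicas of `K`. -/
theorem exists_completely_saturated_packing (d : ℕ) (K : Set (Euc d))
    (hKcpt : IsCompact K) (hKconv : Convex ℝ K) (hKint : (interior K).Nonempty) :
    ∃ P : Set (Set (Euc d)), IsPacking K P ∧ IsCompletelySaturated K P := by
  obtain ⟨c, hc⟩ := hKint
  let e : Euc d ≃ᵢ Euc d := IsometryEquiv.addRight (-c)
  have hconv : Convex ℝ (e '' K) := by
    have := hKconv.translate (-c)
    simpa only [e, IsometryEquiv.addRight_apply, add_comm] using this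
  obtain ⟨P, hP, hPs⟩ := exists_completely_saturated_packing_of_zero_mem_interior
    (hKcpt.image e.continuous) hconv (by
      rw [IsometryEquiv.interior_image]
      exact ⟨c, hc, by simp [e]⟩)
  simp only [IsPacking, IsCompletelySaturated, IsNSaturated, isReplica_image_iff] at hP hPs
  exact ⟨P, hP, hPs⟩
end
end

section
/- Every convex body K in d-dimensional Euclidean space E^d admits a completely reduced covering of E^d with replicas of K. -/
open Set

noncomputable section

/-- A covering of `Euc d` with replicas of `K`: a family of replicas of `K`
whose union is the whole space. -/
def IsCovering {d : ℕ} (K : Set (Euc d)) (C : Set (Set (Euc d))) : Prop :=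
  (∀ L ∈ C, IsReplica K L) ∧ ⋃₀ C = univ

/-- A covering `C` with replicas of `K` is `n`-reduced if one cannot delete `n` members
of `C` and replace them by `n - 1` replicas of `K` so that the result is still a
covering. -/
def IsNReduced {d : ℕ} (K : Set (Euc d)) (C : Set (Set (Euc d))) (n : ℕ) : Prop :=
  ¬ ∃ (S : Set (Set (Euc d))) (L : Fin (n - 1) → Set (Euc d)),
      S ⊆ C ∧ S.Finite ∧ S.ncard = n ∧
      (∀ j, IsReplica K (L j)) ∧
      (⋃₀ (C \ S)) ∪ (⋃ j, L j) = univ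

/-- A covering is completely reduced if it is `n`-reduced for every `n ≥ 1`. -/
def IsCompletelyReduced {d : ℕ} (K : Set (Euc d)) (C : Set (Set (Euc d))) : Prop :=
  ∀ n : ℕ, 1 ≤ n → IsNReduced K C n

section

open Filter Topology Metric

/-- Every point of `Q` is within distance `η` of some replica `f '' K`, `f ∈ F`. -/
def NearlyCovers {d : ℕ} (K : Set (Euc d)) (η : ℝ) (F : Finset (Euc d ≃ᵢ Euc d))
    (Q : Set (Euc d)) : Prop :=
  ∀ y ∈ Q, ∃ f ∈ F, ∃ z ∈ K, dist y (f z) ≤ η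

open scoped Classical in
/-- Finitely many replicas of the family `F`, all inside the ball of radius `r` about `x`, can be
traded for fewer replicas so that the ball is still covered up to gaps of size `η`. -/
def NearlyReducible {d : ℕ} (K : Set (Euc d)) (η : ℝ) (F : Finset (Euc d ≃ᵢ Euc d))
    (x : Euc d) (r : ℝ) : Prop :=
  ∃ S ⊆ F, ∃ T : Finset (Euc d ≃ᵢ Euc d), T.card < S.card ∧
    (∀ f ∈ S, ∀ z ∈ K, f z ∈ closedBall x r) ∧
    NearlyCovers K η ((F \ S) ∪ T) (closedBall x r)

/-- The half-open cube `[0, M * a)^d`. -/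
def cube (d : ℕ) (a : ℝ) (M : ℕ) : Set (Euc d) := {x | ∀ i, 0 ≤ x i ∧ x i < M * a}

/-- The point of the lattice `a ℤ^d` with index `v`. -/
def gridPoint {d : ℕ} (a : ℝ) (v : Fin d → ℕ) : Euc d := WithLp.toLp 2 fun i => (v i : ℝ) * a

/-- The family `F` covers the cube, using as few replicas of `K` as possible. -/
def IsMinimalCover {d : ℕ} (K : Set (Euc d)) (a : ℝ) (M : ℕ)
    (F : Finset (Euc d ≃ᵢ Euc d)) : Prop :=
  NearlyCovers K 0 F (cube d a M) ∧
    ∀ G : Finset (Euc d ≃ᵢ Euc d), NearlyCovers K 0 G (cube d a M) → F.card ≤ G.card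

section Covers

variable {d : ℕ} {K : Set (Euc d)} {c : Euc d} {ρ a : ℝ}

theorem gridPoint_apply (v : Fin d → ℕ) (i : Fin d) : gridPoint a v i = (v i : ℝ) * a := rfl

theorem NearlyCovers.mono {η : ℝ} {F : Finset (Euc d ≃ᵢ Euc d)} {Q Q' : Set (Euc d)}
    (h : NearlyCovers K η F Q) (hQ : Q' ⊆ Q) : NearlyCovers K η F Q' :=
  fun y hy => h y (hQ hy)

/-- Contracting the positions of the replicas by the factor `l` closes gaps of size
`(1 - l) * ρ`. -/
theorem NearlyCovers.contract (hK : Convex ℝ K) (hball : closedBall c ρ ⊆ K)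
    {l : ℝ} (hl0 : 0 < l) (hl1 : l < 1) {F : Finset (Euc d ≃ᵢ Euc d)} {Q : Set (Euc d)}
    (h : NearlyCovers K ((1 - l) * ρ) F Q) :
    ∃ G : Finset (Euc d ≃ᵢ Euc d), G.card ≤ F.card ∧ NearlyCovers K 0 G {y | l⁻¹ • y ∈ Q} := by
  classical
  refine ⟨F.image fun f => f.trans (IsometryEquiv.addRight ((l - 1) • f c)),
    Finset.card_image_le, fun y hy => ?_⟩
  obtain ⟨f, hf, z, hz, hd⟩ := h _ hy
  refine ⟨_, Finset.mem_image_of_mem _ hf, ?_⟩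
  have h1l : 0 < 1 - l := by linarith
  set u : Euc d := l⁻¹ • y - f z with hu
  rw [dist_eq_norm, ← hu] at hd
  set q : Euc d := f c + (l / (1 - l)) • u with hq
  set w : Euc d := f.symm q with hw
  have hfw : f w = q := f.apply_symm_apply q
  have hwK : w ∈ K := by
    apply hball
    rw [mem_closedBall, ← f.dist_eq, hfw, hq, dist_eq_norm, add_sub_cancel_left, norm_smul,
      Real.norm_of_nonneg (by positivity), div_mul_eq_mul_div, div_le_iff₀ h1l]
    nlinarith [norm_nonneg u]
  refine ⟨AffineMap.lineMap w z l, hK.lineMap_mem hwK hz ⟨hl0.le, hl1.le⟩, le_of_eq ?_⟩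
  have hline : f (AffineMap.lineMap w z l) = AffineMap.lineMap (f w) (f z) l :=
    f.toRealAffineIsometryEquiv.toAffineEquiv.toAffineMap.apply_lineMap w z l
  rw [dist_eq_zero]
  simp only [IsometryEquiv.trans_apply, IsometryEquiv.addRight_apply, hline, hfw]
  rw [AffineMap.lineMap_apply_module, hq, hu]
  simp only [smul_add, smul_sub, smul_smul]
  have e1 : (1 - l) * (l / (1 - l)) = l := by field_simp
  have e2 : (1 - l) * (l / (1 - l) * l⁻¹) = 1 := by field_simp
  rw [e1, e2]
  module

theorem exists_cell_size (d : ℕ) {ρ : ℝ} (hρ : 0 < ρ) :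
    ∃ a > 0, ∀ u : Euc d, (∀ i, |u i| ≤ a) → ‖u‖ ≤ ρ := by
  refine ⟨ρ / (d + 1), by positivity, fun u hu => ?_⟩
  rw [EuclideanSpace.norm_eq]
  apply Real.sqrt_le_iff.2 ⟨hρ.le, ?_⟩
  calc ∑ i, ‖u i‖ ^ 2 ≤ ∑ _i : Fin d, (ρ / (d + 1)) ^ 2 :=
        Finset.sum_le_sum fun i _ => pow_le_pow_left₀ (norm_nonneg _) (hu i) 2
    _ = d * (ρ / (d + 1)) ^ 2 := by simp
    _ ≤ (d + 1) ^ 2 * (ρ / (d + 1)) ^ 2 := by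
        gcongr
        nlinarith [(Nat.cast_nonneg d : (0 : ℝ) ≤ d)]
    _ = ρ ^ 2 := by field_simp

/-- A cover of the cube of size `m` extends to the cube of size `M` by adding one replica for each
further cell. -/
theorem NearlyCovers.extend (hball : closedBall c ρ ⊆ K) (ha : 0 < a)
    (hcell : ∀ u : Euc d, (∀ i, |u i| ≤ a) → ‖u‖ ≤ ρ) {m M : ℕ} (hmM : m ≤ M)
    {F : Finset (Euc d ≃ᵢ Euc d)} (hF : NearlyCovers K 0 F (cube d a m)) :
    ∃ G : Finset (Euc d ≃ᵢ Euc d), G.card ≤ F.card + (M ^ d - m ^ d) ∧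
      NearlyCovers K 0 G (cube d a M) := by
  classical
  set cells : ℕ → Finset (Fin d → ℕ) := fun n => Fintype.piFinset fun _ => Finset.range n
  have hcard : (cells M \ cells m).card = M ^ d - m ^ d := by
    rw [Finset.card_sdiff_of_subset]
    · simp [cells]
    · exact Fintype.piFinset_subset _ _ fun _ => Finset.range_subset_range.2 hmM
  refine ⟨F ∪ (cells M \ cells m).image fun v => IsometryEquiv.addRight (gridPoint a v - c),
    (Finset.card_union_le _ _).trans ?_, fun y hy => ?_⟩
  · rw [← hcard]
    gcongr
    exact Finset.card_image_le
  by_cases hym : y ∈ cube d a m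
  · obtain ⟨f, hf, h⟩ := hF y hym
    exact ⟨f, Finset.mem_union_left _ hf, h⟩
  set v : Fin d → ℕ := fun i => ⌊y i / a⌋₊ with hv
  have hv1 : ∀ i, (v i : ℝ) * a ≤ y i := fun i =>
    (le_div_iff₀ ha).1 (Nat.floor_le (div_nonneg (hy i).1 ha.le))
  have hv2 : ∀ i, y i < (v i + 1) * a := fun i => (div_lt_iff₀ ha).1 (Nat.lt_floor_add_one _)
  have hvlt : ∀ (n : ℕ) i, v i < n ↔ y i < n * a := fun n i => by
    rw [hv, Nat.floor_lt (div_nonneg (hy i).1 ha.le), div_lt_iff₀ ha]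
  have hvmem : ∀ n, v ∈ cells n ↔ ∀ i, y i < n * a := fun n => by simp [cells, hvlt]
  have hvc : v ∈ cells M \ cells m := Finset.mem_sdiff.2
    ⟨(hvmem M).2 fun i => (hy i).2, fun h => hym fun i => ⟨(hy i).1, (hvmem m).1 h i⟩⟩
  refine ⟨_, Finset.mem_union_right _ (Finset.mem_image_of_mem _ hvc),
    y - (gridPoint a v - c), hball ?_, ?_⟩
  · rw [mem_closedBall, dist_eq_norm, sub_sub, sub_add_cancel]
    refine hcell _ fun i => ?_
    rw [PiLp.sub_apply, gridPoint_apply, abs_le]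
    constructor <;> nlinarith [hv1 i, hv2 i]
  · simp

/-- Near-reductions at well-separated places can be carried out simultaneously. -/
theorem NearlyCovers.reduce (hKne : K.Nonempty) {η r : ℝ} (hη : 0 ≤ η)
    {F : Finset (Euc d ≃ᵢ Euc d)} {Q : Set (Euc d)} (hF : NearlyCovers K 0 F Q)
    {P : Finset (Euc d)} (hP : ∀ x ∈ P, ∀ y ∈ P, x ≠ y → 2 * r + η < dist x y)
    (hred : ∀ x ∈ P, NearlyReducible K η F x r) :
    ∃ G : Finset (Euc d ≃ᵢ Euc d), G.card + P.card ≤ F.card ∧ NearlyCovers K η G Q := by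
  classical
  choose! S hSF T hTS hball hcov using hred
  obtain ⟨z₀, hz₀⟩ := hKne
  have hdisj : (P : Set (Euc d)).PairwiseDisjoint S := by
    intro x hx y hy hxy
    refine Finset.disjoint_left.2 fun f hfx hfy => ?_
    have h1 := mem_closedBall.1 (hball x hx f hfx z₀ hz₀)
    have h2 := mem_closedBall.1 (hball y hy f hfy z₀ hz₀)
    linarith [hP x hx y hy hxy, dist_triangle_left x y (f z₀)]
  have hsub : P.biUnion S ⊆ F := Finset.biUnion_subset.2 hSF
  refine ⟨(F \ P.biUnion S) ∪ P.biUnion T, ?_, fun y hy => ?_⟩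
  · have h1 := Finset.card_union_le (F \ P.biUnion S) (P.biUnion T)
    have h2 := Finset.card_sdiff_add_card_eq_card hsub
    rw [Finset.card_biUnion hdisj] at h2
    have h3 : (P.biUnion T).card ≤ ∑ x ∈ P, (T x).card := Finset.card_biUnion_le
    have h4 : ∑ x ∈ P, ((T x).card + 1) ≤ ∑ x ∈ P, (S x).card := Finset.sum_le_sum hTS
    rw [Finset.sum_add_distrib, Finset.sum_const, smul_eq_mul, mul_one] at h4
    omega
  obtain ⟨f, hf, z, hz, hfz⟩ := hF y hy
  by_cases hfS : f ∈ P.biUnion S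
  · obtain ⟨x, hx, hfx⟩ := Finset.mem_biUnion.1 hfS
    have hyx : y ∈ closedBall x r := by
      rw [dist_le_zero.1 hfz]
      exact hball x hx f hfx z hz
    obtain ⟨g, hg, w, hw, hgw⟩ := hcov x hx y hyx
    refine ⟨g, ?_, w, hw, hgw⟩
    rcases Finset.mem_union.1 hg with hg | hg
    · obtain ⟨hgF, hgx⟩ := Finset.mem_sdiff.1 hg
      refine Finset.mem_union_left _ (Finset.mem_sdiff.2 ⟨hgF, fun hgS => ?_⟩)
      obtain ⟨x', hx', hgx'⟩ := Finset.mem_biUnion.1 hgS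
      have hne : x ≠ x' := by
        rintro rfl
        exact hgx hgx'
      have h1 := mem_closedBall.1 (hball x' hx' g hgx' w hw)
      linarith [hP x hx x' hx' hne, mem_closedBall.1 hyx, dist_triangle_left x x' y,
        dist_triangle y (g w) x']
    · exact Finset.mem_union_right _ (Finset.mem_biUnion.2 ⟨x, hx, hg⟩)
  · exact ⟨f, Finset.mem_union_left _ (Finset.mem_sdiff.2 ⟨hf, hfS⟩), z, hz, hfz.trans hη⟩

theorem IsMinimalCover.card_le_of_nearlyReducible (hK : Convex ℝ K) (hball : closedBall c ρ ⊆ K)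
    (hρ : 0 < ρ) (ha : 0 < a) (hcell : ∀ u : Euc d, (∀ i, |u i| ≤ a) → ‖u‖ ≤ ρ)
    {l r : ℝ} (hl0 : 0 < l) (hl1 : l < 1) {m M : ℕ} (hm : (m : ℝ) ≤ l * M)
    {F : Finset (Euc d ≃ᵢ Euc d)} (hF : IsMinimalCover K a M F) {P : Finset (Euc d)}
    (hP : ∀ x ∈ P, ∀ y ∈ P, x ≠ y → 2 * r + (1 - l) * ρ < dist x y)
    (hred : ∀ x ∈ P, NearlyReducible K ((1 - l) * ρ) F x r) :
    P.card ≤ M ^ d - m ^ d := by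
  have hη : 0 ≤ (1 - l) * ρ := mul_nonneg (by linarith) hρ.le
  have hKne : K.Nonempty := ⟨c, hball (mem_closedBall_self hρ.le)⟩
  obtain ⟨G, hG, hGcov⟩ := hF.1.reduce hKne hη hP hred
  obtain ⟨H, hH, hHcov⟩ := hGcov.contract hK hball hl0 hl1
  have hmM : m ≤ M := by
    have : (m : ℝ) ≤ M := hm.trans (mul_le_of_le_one_left (Nat.cast_nonneg M) hl1.le)
    exact_mod_cast this
  have hsub : cube d a m ⊆ {y | l⁻¹ • y ∈ cube d a M} := fun y hy i => by
    obtain ⟨h0, h1⟩ := hy i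
    rw [PiLp.smul_apply, smul_eq_mul]
    refine ⟨by positivity, ?_⟩
    rw [inv_mul_lt_iff₀ hl0]
    nlinarith
  obtain ⟨N, hN, hNcov⟩ := (hHcov.mono hsub).extend hball ha hcell hmM
  have := hF.2 N hNcov
  omega

theorem exists_pow_ge (d : ℕ) {ε : ℝ} (hε : 0 < ε) :
    ∃ μ : ℝ, 0 < μ ∧ μ < 1 ∧ 1 - ε < μ ^ d := by
  have h : ∀ᶠ μ : ℝ in 𝓝[<] 1, 1 - ε < μ ^ d := by
    have : Tendsto (fun μ : ℝ => μ ^ d) (𝓝[<] 1) (𝓝 1) := by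
      simpa using ((continuous_pow d).tendsto (1 : ℝ)).mono_left nhdsWithin_le_nhds
    exact this.eventually (lt_mem_nhds (by linarith))
  obtain ⟨μ, h1, h2⟩ := (h.and (Ioo_mem_nhdsLT (zero_lt_one' ℝ))).exists
  exact ⟨μ, h2.1, h2.2, h1⟩

open scoped Classical in
/-- In large optimal covers of cubes, places that are nearly reducible with sufficiently small
gaps are rare. -/
theorem exists_card_nearlyReducible_le (hK : Convex ℝ K) (hball : closedBall c ρ ⊆ K)
    (hρ : 0 < ρ) (ha : 0 < a) (hcell : ∀ u : Euc d, (∀ i, |u i| ≤ a) → ‖u‖ ≤ ρ)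
    (r : ℝ) {ε : ℝ} (hε : 0 < ε) :
    ∃ η > 0, ∀ᶠ M : ℕ in atTop, ∀ F : Finset (Euc d ≃ᵢ Euc d), IsMinimalCover K a M F →
      (((Fintype.piFinset fun _ : Fin d => Finset.range M).filter fun v =>
        NearlyReducible K η F (gridPoint a v) r).card : ℝ) ≤ ε * M ^ d := by
  obtain ⟨p, hp⟩ := exists_nat_gt (max ((2 * r + ρ) / a) 0)
  obtain ⟨hp1, hp0⟩ := max_lt_iff.1 hp
  rw [div_lt_iff₀ ha] at hp1
  obtain ⟨μ, hμ0, hμ1, hμ⟩ := exists_pow_ge d (ε := ε / p ^ d) (by positivity)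
  obtain ⟨l, hμl, hl1⟩ := exists_between hμ1
  have hl0 := hμ0.trans hμl
  refine ⟨(1 - l) * ρ, mul_pos (by linarith) hρ, ?_⟩
  obtain ⟨M₀, hM₀⟩ := exists_nat_gt (1 / (l - μ))
  filter_upwards [eventually_ge_atTop M₀] with M hM F hF
  have hMl : 1 < M * (l - μ) := by
    rw [← div_lt_iff₀ (by linarith)]
    exact hM₀.trans_le (by exact_mod_cast hM)
  have hlM : 0 ≤ l * M := by positivity
  set m := ⌊l * M⌋₊
  have hm1 : (m : ℝ) ≤ l * M := Nat.floor_le hlM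
  have hm2 : μ * M ≤ m := by linarith [Nat.lt_floor_add_one (l * M)]
  have hmM : m ≤ M := by
    have : (m : ℝ) ≤ M := hm1.trans (mul_le_of_le_one_left (Nat.cast_nonneg M) hl1.le)
    exact_mod_cast this
  have hpN : 0 < p := by exact_mod_cast hp0
  set B := (Fintype.piFinset fun _ : Fin d => Finset.range M).filter fun v =>
        NearlyReducible K ((1 - l) * ρ) F (gridPoint a v) r
  have hcount : B.card ≤ (M ^ d - m ^ d) *
      (Fintype.piFinset fun _ : Fin d => Finset.range p).card := by
    refine Finset.card_le_mul_card_image_of_maps_to (f := fun v i => v i % p) ?_ _ fun b _ => ?_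
    · intro v _
      simpa using fun i => Nat.mod_lt _ hpN
    have hsep : ∀ v ∈ B.filter (fun v => (fun i => v i % p) = b),
        ∀ w ∈ B.filter (fun v => (fun i => v i % p) = b), v ≠ w →
        2 * r + (1 - l) * ρ < dist (gridPoint a v : Euc d) (gridPoint a w) := by
      intro v hv w hw hvw
      obtain ⟨i, hi⟩ := Function.ne_iff.1 hvw
      have hmod : v i % p = w i % p :=
        (congrFun (Finset.mem_filter.1 hv).2 i).trans (congrFun (Finset.mem_filter.1 hw).2 i).symm
      have habs : (p : ℝ) ≤ |(v i : ℝ) - w i| := by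
        have hdvd : (p : ℤ) ∣ (v i : ℤ) - w i :=
          (Nat.modEq_iff_dvd.1 (show w i ≡ v i [MOD p] from hmod.symm))
        have h := Int.le_of_dvd (abs_pos.2 (by omega)) ((dvd_abs _ _).2 hdvd)
        exact_mod_cast h
      have hnorm := PiLp.norm_apply_le ((gridPoint a v : Euc d) - gridPoint a w) i
      rw [← dist_eq_norm, PiLp.sub_apply, gridPoint_apply, gridPoint_apply, ← sub_mul,
        Real.norm_eq_abs, abs_mul, abs_of_pos ha] at hnorm
      nlinarith [mul_le_mul_of_nonneg_right habs ha.le]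
    have hinj : Set.InjOn (gridPoint a : (Fin d → ℕ) → Euc d)
        (B.filter (fun v => (fun i => v i % p) = b)) := by
      intro v _ w _ h
      ext i
      have h' := congrArg (fun x : Euc d => x i) h
      simp only [gridPoint_apply] at h'
      exact_mod_cast mul_right_cancel₀ ha.ne' h'
    rw [← Finset.card_image_of_injOn hinj]
    refine hF.card_le_of_nearlyReducible hK hball hρ ha hcell hl0 hl1 hm1 (r := r) ?_ ?_
    · simp only [Finset.forall_mem_image]
      exact fun v hv w hw hvw => hsep v hv w hw fun h => hvw (h ▸ rfl)
    · simp only [Finset.forall_mem_image]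
      exact fun v hv => (Finset.mem_filter.1 (Finset.mem_filter.1 hv).1).2
  have hcount' : (B.card : ℝ) ≤ ((M : ℝ) ^ d - (m : ℝ) ^ d) * (p : ℝ) ^ d := by
    have : (B.card : ℝ) ≤ ((M ^ d - m ^ d : ℕ) : ℝ) *
        ((Fintype.piFinset fun _ : Fin d => Finset.range p).card : ℕ) := by exact_mod_cast hcount
    rw [Nat.cast_sub (Nat.pow_le_pow_left hmM d)] at this
    simpa using this
  have hmd : μ ^ d * (M : ℝ) ^ d ≤ (m : ℝ) ^ d := by
    rw [← mul_pow]
    exact pow_le_pow_left₀ (by positivity) hm2 d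
  calc (B.card : ℝ) ≤ ((M : ℝ) ^ d - (m : ℝ) ^ d) * (p : ℝ) ^ d := hcount'
    _ ≤ (ε / p ^ d * M ^ d) * p ^ d := by
        gcongr
        nlinarith [pow_nonneg (Nat.cast_nonneg M : (0 : ℝ) ≤ M) d]
    _ = ε * M ^ d := by field_simp

theorem exists_isMinimalCover (hball : closedBall c ρ ⊆ K) (hρ : 0 < ρ) (ha : 0 < a)
    (hcell : ∀ u : Euc d, (∀ i, |u i| ≤ a) → ‖u‖ ≤ ρ) (M : ℕ) :
    ∃ F : Finset (Euc d ≃ᵢ Euc d), IsMinimalCover K a M F := by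
  have h0 : NearlyCovers K 0 {IsometryEquiv.refl (Euc d)} (cube d a 0) := fun y hy => by
    refine ⟨_, Finset.mem_singleton_self _, c, hball (mem_closedBall_self hρ.le), ?_⟩
    refine (dist_eq_zero.2 (PiLp.ext fun i => ?_)).le
    have := hy i
    norm_num at this
    linarith
  obtain ⟨G, -, hG⟩ := h0.extend hball ha hcell (Nat.zero_le M)
  obtain ⟨F, hF, hmin⟩ := (measure Finset.card).wf.has_min
    {F : Finset (Euc d ≃ᵢ Euc d) | NearlyCovers K 0 F (cube d a M)} ⟨G, hG⟩
  exact ⟨F, hF, fun H hH => not_lt.1 (hmin H hH)⟩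

/-- There are covers of arbitrarily large balls that cannot be nearly reduced near the center. -/
theorem exists_nearlyCovers_not_nearlyReducible (hK : Convex ℝ K) (hball : closedBall c ρ ⊆ K)
    (hρ : 0 < ρ) :
    ∃ η : ℕ → ℝ, (∀ j, 0 < η j) ∧ ∀ k : ℕ, ∃ (F : Finset (Euc d ≃ᵢ Euc d)) (x : Euc d),
      NearlyCovers K 0 F (closedBall x k) ∧ ∀ j ≤ k, ¬ NearlyReducible K (η j) F x j := by
  classical
  obtain ⟨a, ha, hcell⟩ := exists_cell_size d hρ
  choose η hη hrare using fun j : ℕ =>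
    exists_card_nearlyReducible_le hK hball hρ ha hcell j (ε := 1 / 4 * (1 / 2) ^ j) (by positivity)
  refine ⟨η, hη, fun k => ?_⟩
  obtain ⟨μ, hμ0, hμ1, hμ⟩ := exists_pow_ge d (ε := 1 / 2) (by norm_num)
  obtain ⟨b, hb⟩ := exists_nat_gt ((k : ℝ) / a)
  rw [div_lt_iff₀ ha] at hb
  obtain ⟨M₀, hM₀⟩ := exists_nat_gt (2 * b / (1 - μ))
  obtain ⟨M, hMrare, hMM₀, hM1⟩ := (((Finset.range (k + 1)).eventually_all.2
    fun j _ => hrare j).and ((eventually_ge_atTop M₀).and (eventually_ge_atTop 1))).exists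
  have hMμ : 2 * b < M * (1 - μ) := by
    rw [← div_lt_iff₀ (by linarith)]
    exact hM₀.trans_le (by exact_mod_cast hMM₀)
  have hMpos : (0 : ℝ) < M := by exact_mod_cast hM1
  have h2b : 2 * b ≤ M := by
    have : (2 * b : ℝ) ≤ M := by nlinarith
    exact_mod_cast this
  obtain ⟨F, hF⟩ := exists_isMinimalCover hball hρ ha hcell M
  set inner : Finset (Fin d → ℕ) := Fintype.piFinset fun _ => Finset.Ico b (M - b)
  set bad : ℕ → Finset (Fin d → ℕ) := fun j =>
    (Fintype.piFinset fun _ : Fin d => Finset.range M).filter fun v =>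
        NearlyReducible K (η j) F (gridPoint a v) j
  have hinner : 1 / 2 * (M : ℝ) ^ d < inner.card := by
    have h1 : (inner.card : ℝ) = ((M - 2 * b : ℝ)) ^ d := by
      simp only [inner, Fintype.card_piFinset_const, Nat.card_Ico]
      rw [show M - b - b = M - 2 * b by omega]
      push_cast [Nat.cast_sub h2b]
      rfl
    have h2 : (μ * M) ^ d ≤ (M - 2 * b : ℝ) ^ d :=
      pow_le_pow_left₀ (by positivity) (by linarith) d
    rw [mul_pow] at h2
    rw [h1]
    nlinarith [pow_pos hMpos d]
  have hbad : ((((Finset.range (k + 1)).biUnion bad).card : ℕ) : ℝ) ≤ 1 / 2 * (M : ℝ) ^ d := by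
    calc ((((Finset.range (k + 1)).biUnion bad).card : ℕ) : ℝ)
        ≤ ∑ j ∈ Finset.range (k + 1), ((bad j).card : ℝ) := by
          exact_mod_cast Finset.card_biUnion_le
      _ ≤ ∑ j ∈ Finset.range (k + 1), 1 / 4 * (1 / 2 : ℝ) ^ j * M ^ d :=
          Finset.sum_le_sum fun j hj => hMrare j hj F hF
      _ = 1 / 4 * (∑ j ∈ Finset.range (k + 1), (1 / 2 : ℝ) ^ j) * M ^ d := by
          rw [Finset.mul_sum, Finset.sum_mul]
      _ ≤ 1 / 4 * 2 * M ^ d := by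
          gcongr
          exact sum_geometric_two_le _
      _ = 1 / 2 * (M : ℝ) ^ d := by ring
  obtain ⟨v, hv, hvbad⟩ : ∃ v ∈ inner, v ∉ (Finset.range (k + 1)).biUnion bad := by
    by_contra! h
    have : (inner.card : ℝ) ≤ (((Finset.range (k + 1)).biUnion bad).card : ℕ) := by
      exact_mod_cast Finset.card_le_card h
    linarith
  simp only [inner, Fintype.mem_piFinset, Finset.mem_Ico] at hv
  refine ⟨F, gridPoint a v, hF.1.mono fun y hy i => ?_, fun j hj hred => hvbad ?_⟩
  · have h1 : |y i - v i * a| ≤ b * a := by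
      have h := PiLp.norm_apply_le (y - gridPoint a v) i
      rw [← dist_eq_norm, PiLp.sub_apply, gridPoint_apply, Real.norm_eq_abs] at h
      exact (h.trans (mem_closedBall.1 hy)).trans hb.le
    obtain ⟨h2, h3⟩ := abs_le.1 h1
    have h4 : (b : ℝ) ≤ v i := by exact_mod_cast (hv i).1
    have h5 : (v i : ℝ) + b + 1 ≤ M := by
      have := (hv i).2
      exact_mod_cast (by omega : v i + b + 1 ≤ M)
    constructor <;> nlinarith
  · refine Finset.mem_biUnion.2 ⟨j, Finset.mem_range.2 (by omega), Finset.mem_filter.2 ⟨?_, hred⟩⟩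
    simp only [Fintype.mem_piFinset, Finset.mem_range]
    exact fun i => by
      have := (hv i).2
      omega

end Covers

section Limits

variable {d : ℕ} {K : Set (Euc d)}

/-- A sequence of isometries that stays bounded converges pointwise along an ultrafilter. -/
theorem exists_isometryEquiv_tendsto {ι : Type*} (U : Ultrafilter ι) (f : ι → Euc d ≃ᵢ Euc d)
    (x : ι → Euc d) (c : Euc d) {R : ℝ} (hR : ∀ᶠ k in U, dist (f k c) (x k) ≤ R) :
    ∃ g : Euc d ≃ᵢ Euc d, ∀ z, Tendsto (fun k => f k z - x k) U (𝓝 (g z)) := by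
  have hlim : ∀ {u : ι → Euc d} {q : Euc d} {r : ℝ}, (∀ᶠ k in U, dist (u k) q ≤ r) →
      ∃ p, Tendsto u U (𝓝 p) := fun {u q r} hu => by
    obtain ⟨p, -, hp⟩ := (isCompact_closedBall q r).ultrafilter_le_nhds (U.map u)
      (le_principal_iff.2 hu)
    exact ⟨p, hp⟩
  choose g hg using fun z => hlim (u := fun k => f k z - x k) (q := 0) (r := dist z c + R) (by
    filter_upwards [hR] with k hk
    rw [dist_zero_right, ← dist_eq_norm]
    exact (dist_triangle _ (f k c) _).trans (by rw [(f k).dist_eq]; gcongr))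
  choose h hh using fun y => hlim (u := fun k => (f k).symm (y + x k)) (q := c)
    (r := ‖y‖ + R) (by
      filter_upwards [hR] with k hk
      rw [← (f k).dist_eq, IsometryEquiv.apply_symm_apply]
      refine (dist_triangle _ (x k) _).trans ?_
      rw [dist_comm (x k)]
      gcongr
      simp [dist_eq_norm])
  have hiso : Isometry g := Isometry.of_dist_eq fun y z =>
    tendsto_nhds_unique ((hg y).dist (hg z))
      (tendsto_const_nhds.congr fun k => by rw [dist_sub_right, (f k).dist_eq])
  refine ⟨IsometryEquiv.mk' g h (fun y => ?_) hiso, hg⟩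
  rw [← dist_eq_zero]
  have h1 : Tendsto (fun k => dist (f k (h y) - x k) y) U (𝓝 (dist (g (h y)) y)) :=
    (hg (h y)).dist tendsto_const_nhds
  have h2 : Tendsto (fun k => dist (h y) ((f k).symm (y + x k))) U (𝓝 (dist (h y) (h y))) :=
    tendsto_const_nhds.dist (hh y)
  rw [dist_self] at h2
  refine tendsto_nhds_unique h1 (h2.congr fun k => ?_)
  rw [← (f k).dist_eq, IsometryEquiv.apply_symm_apply, dist_eq_norm, dist_eq_norm]
  congr 1
  abel

/-- The limits along `U` of replicas from the families `F k`, seen from the points `x k`. -/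
def limitFamily (K : Set (Euc d)) {ι : Type*} (U : Ultrafilter ι)
    (F : ι → Finset (Euc d ≃ᵢ Euc d)) (x : ι → Euc d) : Set (Set (Euc d)) :=
  {L | ∃ (f : ι → Euc d ≃ᵢ Euc d) (g : Euc d ≃ᵢ Euc d), (∀ᶠ k in U, f k ∈ F k) ∧
    (∀ z, Tendsto (fun k => f k z - x k) U (𝓝 (g z))) ∧ g '' K = L}

theorem isCovering_limitFamily (hK : IsCompact K) {ι : Type*} {U : Ultrafilter ι}
    {F : ι → Finset (Euc d ≃ᵢ Euc d)} {x : ι → Euc d}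
    (hF : ∀ y : Euc d, ∀ᶠ k in U, ∃ f ∈ F k, ∃ z ∈ K, f z = y + x k) :
    IsCovering K (limitFamily K U F x) := by
  refine ⟨fun L ⟨f, g, _, _, hg⟩ => ⟨g, hg⟩, eq_univ_of_forall fun y => ?_⟩
  have : ∀ k, ∃ (f : Euc d ≃ᵢ Euc d) (z : Euc d),
      (∃ f ∈ F k, ∃ z ∈ K, f z = y + x k) → f ∈ F k ∧ z ∈ K ∧ f z = y + x k := fun k => by
    by_cases h : ∃ f ∈ F k, ∃ z ∈ K, f z = y + x k
    · obtain ⟨f, hf, z, hz, e⟩ := h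
      exact ⟨f, z, fun _ => ⟨hf, hz, e⟩⟩
    · exact ⟨IsometryEquiv.refl _, 0, fun h' => absurd h' h⟩
  choose f z hfz using this
  have hev := (hF y).mono fun k hk => hfz k hk
  obtain ⟨w, hw, hzw⟩ := hK.ultrafilter_le_nhds (U.map z)
    (le_principal_iff.2 (hev.mono fun k hk => hk.2.1))
  replace hzw : Tendsto z U (𝓝 w) := hzw
  have hdist : Tendsto (fun k => dist (z k) w) U (𝓝 0) := by
    simpa using hzw.dist (tendsto_const_nhds (x := w))
  obtain ⟨g, hg⟩ := exists_isometryEquiv_tendsto U f x w (R := 1 + ‖y‖) (by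
    filter_upwards [hev, hdist.eventually (gt_mem_nhds one_pos)] with k hk h1
    refine (dist_triangle _ (f k (z k)) _).trans ?_
    rw [(f k).dist_eq, dist_comm, hk.2.2]
    gcongr
    simp [dist_eq_norm])
  refine ⟨g '' K, ⟨f, g, hev.mono fun k hk => hk.1, hg, rfl⟩, w, hw, ?_⟩
  rw [← dist_eq_zero]
  refine tendsto_nhds_unique ((hg w).dist (tendsto_const_nhds (x := y)))
    (hdist.congr' ?_)
  filter_upwards [hev] with k hk
  rw [← (f k).dist_eq, hk.2.2, dist_comm, dist_eq_norm, dist_eq_norm]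
  congr 1
  abel

theorem isCompletelyReduced_limitFamily (hK : IsCompact K) (hKne : K.Nonempty) {ι : Type*}
    {U : Ultrafilter ι} {F : ι → Finset (Euc d ≃ᵢ Euc d)} {x : ι → Euc d} {η : ℕ → ℝ}
    (hη : ∀ j, 0 < η j) (hF : ∀ j : ℕ, ∀ᶠ k in U, ¬ NearlyReducible K (η j) (F k) (x k) j) :
    IsCompletelyReduced K (limitFamily K U F x) := by
  classical
  rintro n hn ⟨S, L, hSC, hSfin, rfl, hL, hcov⟩
  obtain ⟨z₀, hz₀⟩ := hKne
  obtain ⟨D, hD⟩ : ∃ D, ∀ z ∈ K, dist z z₀ ≤ D := by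
    obtain ⟨D, hD⟩ := hK.isBounded.subset_closedBall z₀
    exact ⟨D, hD⟩
  have hrep : ∀ s, s ∈ S → ∃ (f : ι → Euc d ≃ᵢ Euc d) (g : Euc d ≃ᵢ Euc d),
      (∀ᶠ k in U, f k ∈ F k) ∧ (∀ z, Tendsto (fun k => f k z - x k) U (𝓝 (g z))) ∧ g '' K = s :=
    fun s hs => hSC hs
  have : Nonempty (Euc d ≃ᵢ Euc d) := ⟨IsometryEquiv.refl _⟩
  choose! φ γ hφF hφγ hγ using hrep
  choose h hh using hL
  obtain ⟨j, hj⟩ : ∃ j : ℕ, ∀ s ∈ hSfin.toFinset, ‖γ s z₀‖ + 1 + D ≤ j := by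
    obtain ⟨B, hB⟩ := (hSfin.toFinset.image fun s => ‖γ s z₀‖ + 1 + D).bddAbove
    obtain ⟨j, hj⟩ := exists_nat_ge B
    exact ⟨j, fun s hs => (hB (Finset.mem_coe.2 (Finset.mem_image_of_mem _ hs))).trans hj⟩
  set Sk : ι → Finset (Euc d ≃ᵢ Euc d) := fun k => hSfin.toFinset.image fun s => φ s k with hSk
  set T : ι → Finset (Euc d ≃ᵢ Euc d) := fun k =>
    Finset.univ.image fun i => (h i).trans (IsometryEquiv.addRight (x k))
  have hinj : ∀ᶠ k in U, Set.InjOn (fun s => φ s k) hSfin.toFinset := by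
    have : ∀ᶠ k in U, ∀ s ∈ hSfin.toFinset, ∀ t ∈ hSfin.toFinset, s ≠ t → φ s k ≠ φ t k := by
      refine (eventually_all_finset _).2 fun s hs => (eventually_all_finset _).2 fun t ht => ?_
      rw [hSfin.mem_toFinset] at hs ht
      by_cases hst : s = t
      · exact Eventually.of_forall fun k hne => absurd hst hne
      · simp only [ne_eq, hst, not_false_eq_true, forall_const]
        rw [Ultrafilter.eventually_not]
        intro heq
        refine hst ?_
        rw [← hγ s hs, ← hγ t ht]
        congr 1
        ext1 z
        refine tendsto_nhds_unique ((hφγ s hs z).congr' ?_) (hφγ t ht z)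
        filter_upwards [heq] with k hk
        rw [hk]
    filter_upwards [this] with k hk s hs t ht hst
    by_contra hne
    exact hk s hs t ht hne hst
  have hsub : ∀ᶠ k in U, ∀ s ∈ hSfin.toFinset, φ s k ∈ F k :=
    (eventually_all_finset _).2 fun s hs => hφF s (hSfin.mem_toFinset.1 hs)
  have hloc : ∀ᶠ k in U, ∀ s ∈ hSfin.toFinset, dist (φ s k z₀ - x k) (γ s z₀) < 1 :=
    (eventually_all_finset _).2 fun s hs =>
      (hφγ s (hSfin.mem_toFinset.1 hs) z₀).eventually (ball_mem_nhds _ one_pos)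
  have hgap : ∀ᶠ k in U, NearlyCovers K (η j) ((F k \ Sk k) ∪ T k) (closedBall (x k) j) := by
    by_contra hcon
    rw [← Ultrafilter.eventually_not] at hcon
    have : ∀ k, ∃ y, ¬ NearlyCovers K (η j) ((F k \ Sk k) ∪ T k) (closedBall (x k) j) →
        y ∈ closedBall (x k) j ∧ ∀ f ∈ (F k \ Sk k) ∪ T k, ∀ z ∈ K, η j < dist y (f z) :=
      fun k => by
        by_cases hk : NearlyCovers K (η j) ((F k \ Sk k) ∪ T k) (closedBall (x k) j)
        · exact ⟨0, fun h => absurd hk h⟩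
        · have hk' := hk
          unfold NearlyCovers at hk'
          push Not at hk'
          obtain ⟨y, hy⟩ := hk'
          exact ⟨y, fun _ => hy⟩
    choose y hy using this
    replace hy := hcon.mono fun k hk => hy k hk
    obtain ⟨p, -, hp⟩ := (isCompact_closedBall (0 : Euc d) j).ultrafilter_le_nhds
      (U.map fun k => y k - x k) (le_principal_iff.2 (hy.mono fun k hk => by
        simpa [dist_eq_norm] using hk.1))
    replace hp : Tendsto (fun k => y k - x k) U (𝓝 p) := hp
    have hpcov : p ∈ ⋃₀ (limitFamily K U F x \ S) ∪ ⋃ i, L i := hcov ▸ mem_univ p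
    rcases hpcov with ⟨s, ⟨⟨f, g, hfF, hfg, rfl⟩, hsS⟩, z, hz, rfl⟩ | hpL
    · have hfS : ∀ᶠ k in U, f k ∉ Sk k := by
        rw [Ultrafilter.eventually_not]
        intro hmem
        have hmem' : ∀ᶠ k in U, ∃ s ∈ (hSfin.toFinset : Set (Set (Euc d))), φ s k = f k :=
          hmem.mono fun k hk => Finset.mem_image.1 hk
        obtain ⟨s, hs, hsk⟩ :=
          (Ultrafilter.eventually_exists_mem_iff (Finset.finite_toSet _)).1 hmem'
        replace hs : s ∈ S := hSfin.mem_toFinset.1 hs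
        refine hsS ?_
        have : g = γ s := by
          ext1 w
          refine tendsto_nhds_unique ((hfg w).congr' ?_) (hφγ s hs w)
          filter_upwards [hsk] with k hk
          rw [hk]
        rwa [this, hγ s hs]
      have hd : Tendsto (fun k => dist (y k - x k) (f k z - x k)) U (𝓝 0) := by
        simpa using hp.dist (hfg z)
      obtain ⟨k, h1, h2, h3, h4⟩ :=
        (hfS.and (hfF.and (hy.and (hd.eventually (gt_mem_nhds (hη j)))))).exists
      rw [dist_sub_right] at h4
      exact (h3.2 (f k) (Finset.mem_union_left _ (Finset.mem_sdiff.2 ⟨h2, h1⟩)) z hz).not_gt h4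
    · obtain ⟨i, hi⟩ := mem_iUnion.1 hpL
      rw [← hh i] at hi
      obtain ⟨z, hz, rfl⟩ := hi
      obtain ⟨k, h1, h2⟩ := (hy.and (hp.eventually (ball_mem_nhds _ (hη j)))).exists
      refine (h1.2 _ (Finset.mem_union_right _ (Finset.mem_image_of_mem _ (Finset.mem_univ i)))
        z hz).not_gt ?_
      change dist (y k - x k) (h i z) < η j at h2
      simpa [dist_eq_norm, sub_sub, add_comm] using h2
  obtain ⟨k, h1, h2, h3, h4, h5⟩ :=
    (hinj.and (hsub.and (hloc.and (hgap.and (hF j))))).exists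
  refine h5 ⟨Sk k, fun f hf => ?_, T k, ?_, fun f hf z hz => ?_, h4⟩
  · obtain ⟨s, hs, rfl⟩ := Finset.mem_image.1 hf
    exact h2 s hs
  · rw [hSk, Finset.card_image_of_injOn h1, ← Set.ncard_eq_toFinset_card S hSfin]
    have : (T k).card ≤ S.ncard - 1 := Finset.card_image_le.trans (by simp)
    omega
  · obtain ⟨s, hs, rfl⟩ := Finset.mem_image.1 hf
    rw [mem_closedBall]
    have e1 : dist (φ s k z) (φ s k z₀) ≤ D := by
      rw [(φ s k).dist_eq]
      exact hD z hz
    have e2 := dist_triangle (φ s k z₀ - x k) (γ s z₀) 0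
    rw [dist_zero_right, dist_zero_right, ← dist_eq_norm] at e2
    linarith [hj s hs, h3 s hs, dist_triangle (φ s k z) (φ s k z₀) (x k)]

end Limits

end

/-- Every convex body `K` in `Euc d` admits a completely reduced covering of `Euc d`
with replicas of `K`. -/
theorem exists_completely_reduced_covering (d : ℕ) (K : Set (Euc d))
    (hKcpt : IsCompact K) (hKconv : Convex ℝ K) (hKint : (interior K).Nonempty) :
    ∃ C : Set (Set (Euc d)), IsCovering K C ∧ IsCompletelyReduced K C := by
  obtain ⟨c, hc⟩ := hKint
  obtain ⟨ρ, hρ, hball⟩ := Metric.nhds_basis_closedBall.mem_iff.1 (mem_interior_iff_mem_nhds.1 hc)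
  obtain ⟨η, hη, h⟩ := exists_nearlyCovers_not_nearlyReducible hKconv hball hρ
  choose F x hcov hred using h
  have hlarge : ∀ m : ℕ, ∀ᶠ k in Filter.hyperfilter ℕ, m ≤ k := fun m =>
    Nat.hyperfilter_le_atTop (Filter.eventually_ge_atTop m)
  refine ⟨limitFamily K (Filter.hyperfilter ℕ) F x, isCovering_limitFamily hKcpt fun y => ?_,
    isCompletelyReduced_limitFamily hKcpt ⟨c, interior_subset hc⟩ hη fun j =>
      (hlarge j).mono fun k hk => hred k j hk⟩
  obtain ⟨m, hm⟩ := exists_nat_ge ‖y‖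
  filter_upwards [hlarge m] with k hk
  obtain ⟨f, hf, z, hz, hd⟩ := hcov k (y + x k) (by
    have : (m : ℝ) ≤ k := by exact_mod_cast hk
    simpa [dist_eq_norm] using hm.trans this)
  exact ⟨f, hf, z, hz, (dist_le_zero.1 hd).symm⟩
end
end

section
/- Let K be a body in E^d with the strict nested similarity property, i.e., for every real h with 0 < h < 1 the interior of K contains a replica of the scaled set h·K. Then there exist a completely saturated packing of E^d with replicas of K and a completely reduced covering of E^d with replicas of K. -/
open Set Pointwise

noncomputable section

/-- A body: a nonempty compact connected set equal to the closure of its interior. -/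
def IsBody {d : ℕ} (K : Set (Euc d)) : Prop :=
  K.Nonempty ∧ IsCompact K ∧ IsConnected K ∧ K = closure (interior K)

/-- The strict nested similarity property: for every `0 < h < 1`, the interior of `K`
contains a replica of the scaled set `h • K`. -/
def StrictNestedSimilarity {d : ℕ} (K : Set (Euc d)) : Prop :=
  ∀ h : ℝ, 0 < h → h < 1 → ∃ L : Set (Euc d), IsReplica (h • K) L ∧ L ⊆ interior K

open Metric Filter Topology MeasureTheory

/-- The total volume of finitely many disjoint balls inside a ball. -/
theorem card_mul_pow_le_of_disjoint_balls {d : ℕ} {ι : Type*} (X : Finset ι) (c : ι → Euc d)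
    {r R : ℝ} (hr : 0 < r) (hR : 0 ≤ R)
    (hdisj : (X : Set ι).PairwiseDisjoint fun i => ball (c i) r)
    (hsub : ∀ i ∈ X, ball (c i) r ⊆ closedBall 0 R) :
    (X.card : ℝ) * r ^ d ≤ R ^ d := by
  have h : volume (⋃ i ∈ X, ball (c i) r) ≤ volume (closedBall (0 : Euc d) R) :=
    measure_mono (iUnion₂_subset hsub)
  rw [measure_biUnion_finset hdisj fun _ _ => measurableSet_ball] at h
  simp only [Measure.addHaar_ball_of_pos _ _ hr, Measure.addHaar_closedBall _ _ hR,
    finrank_euclideanSpace, Fintype.card_fin, Finset.sum_const, nsmul_eq_mul] at h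
  rw [← mul_assoc, ENNReal.mul_le_mul_iff_left (measure_ball_pos _ _ one_pos).ne'
    measure_ball_lt_top.ne, ← ENNReal.ofReal_natCast,
    ← ENNReal.ofReal_mul (by positivity), ENNReal.ofReal_le_ofReal_iff (by positivity)] at h
  exact h

/-- The volume of a ball covered by finitely many families of balls. -/
theorem pow_le_sum_of_closedBall_subset {d : ℕ} (M : ℕ) (X : ℕ → Finset (Euc d)) (t : ℕ → ℝ)
    (ht : ∀ m, 0 ≤ t m) {R : ℝ} (hR : 0 ≤ R)
    (h : closedBall (0 : Euc d) R ⊆ ⋃ m ∈ Finset.range M, ⋃ x ∈ X m, closedBall x (t m)) :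
    R ^ d ≤ ∑ m ∈ Finset.range M, ((X m).card : ℝ) * t m ^ d := by
  have h1 : volume (closedBall (0 : Euc d) R) ≤
      ∑ m ∈ Finset.range M, ∑ x ∈ X m, volume (closedBall x (t m)) :=
    (measure_mono h).trans <| (measure_biUnion_finset_le _ _).trans <|
      Finset.sum_le_sum fun m _ => measure_biUnion_finset_le _ _
  have h2 : ∀ m, ∀ x : Euc d, volume (closedBall x (t m)) =
      ENNReal.ofReal (t m ^ d) * volume (ball (0 : Euc d) 1) := fun m x => by
    simp [Measure.addHaar_closedBall _ _ (ht m)]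
  simp only [h2, Measure.addHaar_closedBall _ _ hR,
    finrank_euclideanSpace, Fintype.card_fin, Finset.sum_const, nsmul_eq_mul, ← mul_assoc,
    ← Finset.sum_mul] at h1
  rw [ENNReal.mul_le_mul_iff_left (measure_ball_pos _ _ one_pos).ne'
    measure_ball_lt_top.ne] at h1
  have h3 : ∀ m, ((X m).card : ENNReal) * ENNReal.ofReal (t m ^ d) =
      ENNReal.ofReal ((X m).card * t m ^ d) := fun m => by
    rw [ENNReal.ofReal_mul (by positivity), ENNReal.ofReal_natCast]
  simp only [h3] at h1
  rw [← ENNReal.ofReal_sum_of_nonneg fun m _ => mul_nonneg (Nat.cast_nonneg _)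
    (pow_nonneg (ht m) _)] at h1
  exact (ENNReal.ofReal_le_ofReal_iff (Finset.sum_nonneg fun m _ => mul_nonneg (Nat.cast_nonneg _)
    (pow_nonneg (ht m) _))).1 h1

theorem card_mul_pow_le_of_separated {d : ℕ} (X : Finset (Euc d)) {t R : ℝ} (ht : 0 < t)
    (hR : 0 ≤ R) (hsep : (X : Set (Euc d)).Pairwise fun x y => t < dist x y)
    (hsub : (X : Set (Euc d)) ⊆ closedBall 0 R) :
    (X.card : ℝ) * (t / 2) ^ d ≤ (R + t / 2) ^ d := by
  refine card_mul_pow_le_of_disjoint_balls X id (by positivity) (by positivity) ?_ ?_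
  · intro x hx y hy hxy
    exact ball_disjoint_ball (by linarith [hsep hx hy hxy, show dist (id x) (id y) = dist x y from rfl])
  · intro x hx
    refine ball_subset_closedBall.trans (closedBall_subset_closedBall' ?_)
    have := mem_closedBall.1 (hsub hx)
    simp only [id]
    linarith

/-- A maximal separated subset of a bounded set. -/
theorem exists_maximal_separated {d : ℕ} (B : Set (Euc d)) {t R : ℝ} (ht : 0 < t) (hR : 0 ≤ R)
    (hB : B ⊆ closedBall 0 R) :
    ∃ X : Finset (Euc d), (X : Set (Euc d)) ⊆ B ∧
      (X : Set (Euc d)).Pairwise (fun x y => t < dist x y) ∧ ∀ b ∈ B, ∃ x ∈ X, dist b x ≤ t := by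
  classical
  let S : Set ℕ := {n | ∃ X : Finset (Euc d), X.card = n ∧ (X : Set (Euc d)) ⊆ B ∧
      (X : Set (Euc d)).Pairwise (fun x y => t < dist x y)}
  have hS : S.Nonempty := ⟨0, ∅, by simp⟩
  have hbdd : BddAbove S := by
    refine ⟨⌊(R + t / 2) ^ d / (t / 2) ^ d⌋₊, ?_⟩
    rintro n ⟨X, rfl, hX, hsep⟩
    rw [Nat.le_floor_iff (by positivity), le_div_iff₀ (by positivity)]
    exact card_mul_pow_le_of_separated X ht hR hsep (hX.trans hB)
  obtain ⟨X, hcard, hXB, hsep⟩ := Nat.sSup_mem hS hbdd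
  refine ⟨X, hXB, hsep, fun b hb => ?_⟩
  by_contra! hfar
  have hbX : b ∉ X := fun h => by simpa using (ht.trans (hfar b h))
  have : (insert b X).card ∈ S := by
    refine ⟨_, rfl, ?_, ?_⟩
    · simpa [insert_subset_iff] using ⟨hb, hXB⟩
    · rw [Finset.coe_insert]
      exact hsep.insert fun y hy _ => ⟨hfar y hy, dist_comm b y ▸ hfar y hy⟩
  have := le_csSup hbdd this
  rw [Finset.card_insert_of_notMem hbX] at this
  omega

/-- The upper growth rate of a function of order `R ^ d`. -/
theorem exists_upper_growth_rate {d : ℕ} {F : ℝ → ℝ} {C : ℝ}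
    (hF : ∀ R, 1 ≤ R → |F R| ≤ C * R ^ d) :
    ∃ c : ℝ, ∀ η > 0, (∀ᶠ R in atTop, F R ≤ (c + η) * R ^ d) ∧
      ∃ᶠ R in atTop, (c - η) * R ^ d ≤ F R := by
  have hb : ∀ᶠ R in atTop, |F R / R ^ d| ≤ C := by
    filter_upwards [eventually_ge_atTop 1] with R hR
    have : 0 < R ^ d := by positivity
    rw [abs_div, abs_of_pos this, div_le_iff₀ this]
    exact hF R hR
  have hbd : IsBoundedUnder (· ≤ ·) atTop fun R => F R / R ^ d :=
    ⟨C, hb.mono fun R h => (abs_le.1 h).2⟩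
  have hcobd : IsCoboundedUnder (· ≤ ·) atTop fun R => F R / R ^ d :=
    IsBoundedUnder.isCoboundedUnder_le ⟨-C, hb.mono fun R h => (abs_le.1 h).1⟩
  refine ⟨limsup (fun R => F R / R ^ d) atTop, fun η hη => ⟨?_, ?_⟩⟩
  · filter_upwards [eventually_lt_of_limsup_lt (lt_add_of_pos_right _ hη) hbd,
      eventually_ge_atTop 1] with R h hR
    exact ((div_lt_iff₀ (by positivity)).1 h).le
  · refine ((frequently_lt_of_lt_limsup hcobd (sub_lt_self _ hη)).and_eventually
      (eventually_ge_atTop 1)).mono ?_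
    rintro R ⟨h, hR⟩
    exact ((lt_div_iff₀ (by positivity)).1 h).le

/-- If `F` has order `R ^ d`, then for scales `h m` close to `1` there are large radii `R` at which
the increments of `F` from `R` to `h m * R` are small. -/
theorem exists_scales_with_small_increments {d : ℕ} {F : ℝ → ℝ} {C : ℝ}
    (hF : ∀ R, 1 ≤ R → |F R| ≤ C * R ^ d) {s : Set ℝ} (hs : (𝓝[s] (1 : ℝ)).NeBot)
    (hs0 : ∀ x ∈ s, 0 < x) :
    ∃ h : ℕ → ℝ, (∀ m, h m ∈ s) ∧ ∀ (M : ℕ) (B : ℝ), ∃ R, B ≤ R ∧ ∀ k : ℕ → ℕ,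
      (∀ m < M, F R + k m ≤ F (h m * R)) →
        ∑ m ∈ Finset.range M, (k m : ℝ) * (2 * ((m : ℝ) + 1)) ^ d < (R - M) ^ d := by
  obtain ⟨c, hc⟩ := exists_upper_growth_rate hF
  have hscale : ∀ m : ℕ, ∃ x ∈ s,
      (2 * ((m : ℝ) + 1)) ^ d * (c * x ^ d - c) < (1 / 2) ^ (m + 2) := by
    intro m
    have hcont : Continuous fun x : ℝ => (2 * ((m : ℝ) + 1)) ^ d * (c * x ^ d - c) := by fun_prop
    have h1 : ∀ᶠ x in 𝓝 (1 : ℝ),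
        (2 * ((m : ℝ) + 1)) ^ d * (c * x ^ d - c) < (1 / 2) ^ (m + 2) := by
      refine hcont.continuousAt.eventually_lt continuousAt_const ?_
      simp
    obtain ⟨x, hx1, hx2⟩ := ((h1.filter_mono nhdsWithin_le_nhds).and
      (eventually_mem_nhdsWithin (s := s))).exists
    exact ⟨x, hx2, hx1⟩
  choose h hhs hh using hscale
  refine ⟨h, hhs, fun M B => ?_⟩
  have hη : ∃ η > 0, ∀ m ∈ Finset.range M,
      (2 * ((m : ℝ) + 1)) ^ d * ((c + η) * h m ^ d - (c - η)) < (1 / 2) ^ (m + 2) := by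
    have : ∀ᶠ η in 𝓝[>] (0 : ℝ), 0 < η ∧ ∀ m ∈ Finset.range M,
        (2 * ((m : ℝ) + 1)) ^ d * ((c + η) * h m ^ d - (c - η)) < (1 / 2) ^ (m + 2) := by
      refine eventually_and.2 ⟨self_mem_nhdsWithin, mem_nhdsWithin_of_mem_nhds ?_⟩
      refine (Filter.eventually_all_finset _).2 fun m _ => ?_
      have hcont : Continuous fun η : ℝ =>
        (2 * ((m : ℝ) + 1)) ^ d * ((c + η) * h m ^ d - (c - η)) := by fun_prop
      refine hcont.continuousAt.eventually_lt continuousAt_const ?_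
      simpa using hh m
    exact this.exists
  obtain ⟨η, hη0, hη⟩ := hη
  have hup : ∀ᶠ R in atTop, ∀ m ∈ Finset.range M, F (h m * R) ≤ (c + η) * (h m * R) ^ d :=
    (Filter.eventually_all_finset _).2 fun m _ =>
      (tendsto_id.const_mul_atTop (hs0 _ (hhs m))).eventually (hc η hη0).1
  have hhalf : ∀ᶠ R : ℝ in atTop, 1 / 2 < (1 - M / R) ^ d := by
    have : Tendsto (fun R : ℝ => (1 - M / R) ^ d) atTop (𝓝 ((1 - 0) ^ d)) :=
      ((tendsto_const_nhds.sub (tendsto_const_nhds.div_atTop tendsto_id))).pow d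
    exact this.eventually_const_lt (by norm_num)
  obtain ⟨R, hlow, hup, hhalf, hRB, hR1⟩ := ((hc η hη0).2.and_eventually (hup.and (hhalf.and
    ((eventually_ge_atTop B).and (eventually_ge_atTop 1))))).exists
  refine ⟨R, hRB, fun k hk => ?_⟩
  have hRd : 0 < R ^ d := by positivity
  have hterm : ∀ m ∈ Finset.range M, (k m : ℝ) * (2 * ((m : ℝ) + 1)) ^ d ≤
      R ^ d * (1 / 2) ^ (m + 2) := by
    intro m hm
    have h1 : (k m : ℝ) ≤ R ^ d * ((c + η) * h m ^ d - (c - η)) := by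
      have := hup m hm
      rw [mul_pow] at this
      linarith [hk m (Finset.mem_range.1 hm)]
    calc (k m : ℝ) * (2 * ((m : ℝ) + 1)) ^ d
        ≤ R ^ d * ((c + η) * h m ^ d - (c - η)) * (2 * ((m : ℝ) + 1)) ^ d := by gcongr
      _ = R ^ d * ((2 * ((m : ℝ) + 1)) ^ d * ((c + η) * h m ^ d - (c - η))) := by ring
      _ ≤ R ^ d * (1 / 2) ^ (m + 2) := by gcongr; exact (hη m hm).le
  have hgeom : ∑ m ∈ Finset.range M, (1 / 2 : ℝ) ^ (m + 2) ≤ 1 / 2 := by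
    simp only [pow_add, ← Finset.sum_mul]
    rw [geom_sum_eq (by norm_num)]
    have : (0 : ℝ) < (1 / 2) ^ M := by positivity
    generalize (1 / 2 : ℝ) ^ M = q at this ⊢
    linarith [show (q - 1) / (1 / 2 - 1) * (1 / 2) ^ 2 = 1 / 2 - q / 2 by ring]
  calc ∑ m ∈ Finset.range M, (k m : ℝ) * (2 * ((m : ℝ) + 1)) ^ d
      ≤ ∑ m ∈ Finset.range M, R ^ d * (1 / 2) ^ (m + 2) := Finset.sum_le_sum hterm
    _ ≤ R ^ d * (1 / 2) := by rw [← Finset.mul_sum]; gcongr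
    _ < R ^ d * (1 - M / R) ^ d := by gcongr
    _ = (R - M) ^ d := by rw [← mul_pow]; congr 1; field_simp

/-- If `F` has order `R ^ d` and separated bad points force increments of `F`, then some large ball
has a point that is not bad at any of the first `M` scales. -/
theorem exists_good_center {d : ℕ} {F : ℝ → ℝ} {C : ℝ}
    (hF : ∀ R, 1 ≤ R → |F R| ≤ C * R ^ d) {s : Set ℝ} (hs : (𝓝[s] (1 : ℝ)).NeBot)
    (hs0 : ∀ x ∈ s, 0 < x) :
    ∃ h : ℕ → ℝ, (∀ m, h m ∈ s) ∧ ∀ (M : ℕ) (B : ℝ), ∃ R, B ≤ R ∧ M ≤ R ∧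
      ∀ bad : ℕ → Euc d → Prop,
        (∀ m < M, ∀ X : Finset (Euc d), (∀ x ∈ X, x ∈ closedBall 0 (R - M) ∧ bad m x) →
          ((X : Set (Euc d)).Pairwise fun x y => 2 * ((m : ℝ) + 1) < dist x y) →
          F R + X.card ≤ F (h m * R)) →
        ∃ x ∈ closedBall (0 : Euc d) (R - M), ∀ m < M, ¬ bad m x := by
  obtain ⟨h, hhs, H⟩ := exists_scales_with_small_increments hF hs hs0
  refine ⟨h, hhs, fun M B => ?_⟩
  obtain ⟨R, hBR, hR⟩ := H M (max B M)
  have hMR : (M : ℝ) ≤ R := (le_max_right _ _).trans hBR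
  refine ⟨R, (le_max_left _ _).trans hBR, hMR, fun bad hbad => ?_⟩
  by_contra! hall
  have hRM : 0 ≤ R - M := sub_nonneg.2 hMR
  have hX : ∀ m : ℕ, ∃ X : Finset (Euc d),
      (X : Set (Euc d)) ⊆ {x | x ∈ closedBall 0 (R - M) ∧ bad m x} ∧
      (X : Set (Euc d)).Pairwise (fun x y => 2 * ((m : ℝ) + 1) < dist x y) ∧
      ∀ b ∈ {x | x ∈ closedBall 0 (R - M) ∧ bad m x}, ∃ x ∈ X, dist b x ≤ 2 * ((m : ℝ) + 1) :=
    fun m => exists_maximal_separated _ (by positivity) hRM fun x hx => hx.1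
  choose X hXsub hXsep hXcov using hX
  refine (hR (fun m => (X m).card) fun m hm =>
    hbad m hm (X m) (fun x hx => hXsub m hx) (hXsep m)).not_ge ?_
  refine pow_le_sum_of_closedBall_subset M X _ (fun m => by positivity) hRM fun y hy => ?_
  obtain ⟨m, hm, hbm⟩ := hall y hy
  obtain ⟨x, hx, hxy⟩ := hXcov m y ⟨hy, hbm⟩
  simp only [mem_iUnion, Finset.mem_range]
  exact ⟨m, hm, x, hx, hxy⟩

section Replicas

variable {d : ℕ} {K L Q : Set (Euc d)}

theorem image_trans_isometryEquiv (f e : Euc d ≃ᵢ Euc d) (L : Set (Euc d)) :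
    f.trans e '' L = e '' (f '' L) :=
  image_comp e f L

theorem IsReplica.refl (K : Set (Euc d)) : IsReplica K K :=
  ⟨IsometryEquiv.refl _, image_id K⟩

theorem IsReplica.trans (h : IsReplica K L) (h' : IsReplica L Q) : IsReplica K Q := by
  obtain ⟨f, rfl⟩ := h
  obtain ⟨e, rfl⟩ := h'
  exact ⟨f.trans e, image_trans_isometryEquiv f e K⟩

theorem IsReplica.image (e : Euc d ≃ᵢ Euc d) (h : IsReplica K L) : IsReplica K (e '' L) :=
  h.trans ⟨e, rfl⟩

theorem IsReplica.smul {h : ℝ} (hh : h ≠ 0) (hL : IsReplica K L) :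
    IsReplica (h • K) (h • L) := by
  obtain ⟨f, rfl⟩ := hL
  let e : Euc d ≃ Euc d := (Homeomorph.smulOfNeZero h hh).toEquiv
  refine ⟨⟨(e.symm.trans f.toEquiv).trans e, Isometry.of_dist_eq fun x y => ?_⟩, ?_⟩
  · change dist (h • f (h⁻¹ • x)) (h • f (h⁻¹ • y)) = _
    rw [dist_smul₀, f.dist_eq, dist_smul₀]
    rw [← mul_assoc, ← norm_mul, mul_inv_cancel₀ hh, norm_one, one_mul]
  · ext y
    simp only [← image_smul, image_image, mem_image]
    refine exists_congr fun x => and_congr_right fun _ => ?_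
    change h • f (h⁻¹ • h • x) = y ↔ _
    rw [inv_smul_smul₀ hh]

theorem interior_image_isometryEquiv (e : Euc d ≃ᵢ Euc d) (L : Set (Euc d)) :
    interior (e '' L) = e '' interior L :=
  (e.toHomeomorph.image_interior L).symm

theorem IsReplica.interior_nonempty (h : IsReplica K L) (hK : (interior K).Nonempty) :
    (interior L).Nonempty := by
  obtain ⟨f, rfl⟩ := h
  rw [interior_image_isometryEquiv]
  exact hK.image _

theorem IsReplica.isCompact (h : IsReplica K L) (hK : IsCompact K) : IsCompact L := by
  obtain ⟨f, rfl⟩ := h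
  exact hK.image f.continuous

theorem IsBody.interior_nonempty (hK : IsBody K) : (interior K).Nonempty := by
  rw [← closure_nonempty_iff, ← hK.2.2.2]
  exact hK.1

theorem IsReplica.exists_closedBall_subset {r : ℝ} (h : IsReplica K L) {p : Euc d}
    (hp : closedBall p r ⊆ K) : ∃ c, closedBall c r ⊆ L := by
  obtain ⟨f, rfl⟩ := h
  exact ⟨f p, by rw [← f.image_closedBall]; exact image_mono hp⟩

theorem IsBody.exists_closedBall_subset (hK : IsBody K) : ∃ p, ∃ r > 0, closedBall p r ⊆ K := by
  obtain ⟨p, hp⟩ := hK.interior_nonempty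
  obtain ⟨r, hr, h⟩ := nhds_basis_closedBall.mem_iff.1 (mem_interior_iff_mem_nhds.1 hp)
  exact ⟨p, r, hr, h⟩

theorem StrictNestedSimilarity.exists_subset_interior (hsim : StrictNestedSimilarity K)
    {s : ℝ} (h0 : 0 < s) (h1 : s < 1) (hL : IsReplica K L) :
    ∃ T, IsReplica (s • K) T ∧ T ⊆ interior L := by
  obtain ⟨f, rfl⟩ := hL
  obtain ⟨T, hT, hTK⟩ := hsim s h0 h1
  exact ⟨f '' T, hT.image f, by rw [interior_image_isometryEquiv]; exact image_mono hTK⟩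

theorem StrictNestedSimilarity.exists_superset (hsim : StrictNestedSimilarity K)
    {s : ℝ} (h1 : 1 < s) : ∃ T, IsReplica (s • K) T ∧ K ⊆ interior T := by
  have hs : 0 < s := one_pos.trans h1
  obtain ⟨T, hT, hTK⟩ := hsim s⁻¹ (by positivity) (inv_lt_one_of_one_lt₀ h1)
  obtain ⟨f, hf⟩ := hT.smul hs.ne'
  rw [smul_inv_smul₀ hs.ne'] at hf
  refine ⟨f.symm '' (s • K), ⟨f.symm, rfl⟩, ?_⟩
  rw [interior_image_isometryEquiv, IsometryEquiv.image_symm, ← image_subset_iff, hf,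
    interior_smul₀ hs.ne']
  exact smul_set_mono hTK

end Replicas

section Packing

variable {d : ℕ} {K Q : Set (Euc d)}

/-- `n` replicas of `K` can be packed into the ball of radius `R`. -/
def PacksBall {d : ℕ} (K : Set (Euc d)) (R : ℝ) (n : ℕ) : Prop :=
  ∃ A : Fin n → Set (Euc d), (∀ i, IsReplica K (A i)) ∧
    (Pairwise fun i j => Disjoint (interior (A i)) (interior (A j))) ∧
    ∀ i, A i ⊆ closedBall 0 R

/-- Some members of the family `A` inside a ball can be replaced by a larger number of replicas of
`Q` inside that ball. -/
def ImprovablePacking {d : ℕ} {ι : Type*} (A : ι → Set (Euc d)) (Q : Set (Euc d)) (x : Euc d)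
    (ρ : ℝ) : Prop :=
  ∃ (D : Finset ι) (k : ℕ) (T : Fin k → Set (Euc d)), D.card < k ∧
    (∀ i ∈ D, A i ⊆ closedBall x ρ) ∧ (∀ j, IsReplica Q (T j)) ∧ (∀ j, T j ⊆ closedBall x ρ) ∧
    (Pairwise fun i j => Disjoint (interior (T i)) (interior (T j))) ∧
    ∀ j, ∀ i ∉ D, Disjoint (interior (T j)) (interior (A i))

theorem ImprovablePacking.image {ι : Type*} {A : ι → Set (Euc d)} {x : Euc d} {ρ : ℝ}
    (h : ImprovablePacking A Q x ρ) (e : Euc d ≃ᵢ Euc d) :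
    ImprovablePacking (fun i => e '' A i) Q (e x) ρ := by
  obtain ⟨D, k, T, hk, hD, hT, hTb, hTd, hTA⟩ := h
  refine ⟨D, k, fun j => e '' T j, hk, fun i hi => ?_, fun j => (hT j).image e, fun j => ?_,
    fun i j hij => ?_, fun j i hi => ?_⟩
  · rw [← e.image_closedBall]; exact image_mono (hD i hi)
  · rw [← e.image_closedBall]; exact image_mono (hTb j)
  · simp only [interior_image_isometryEquiv]
    exact (disjoint_image_iff e.injective).2 (hTd hij)
  · simp only [interior_image_isometryEquiv]
    exact (disjoint_image_iff e.injective).2 (hTA j i hi)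

theorem PacksBall.of_fintype {ι : Type*} [Fintype ι] {R : ℝ} (A : ι → Set (Euc d))
    (hA : ∀ i, IsReplica K (A i))
    (hd : Pairwise fun i j => Disjoint (interior (A i)) (interior (A j)))
    (hR : ∀ i, A i ⊆ closedBall 0 R) : PacksBall K R (Fintype.card ι) :=
  ⟨A ∘ (Fintype.equivFin ι).symm, fun _ => hA _,
    fun _ _ hij => hd ((Fintype.equivFin ι).symm.injective.ne hij), fun _ => hR _⟩

theorem PacksBall.smul {R h : ℝ} {n : ℕ} (hh : 0 < h) (H : PacksBall K R n) :
    PacksBall (h • K) (h * R) n := by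
  obtain ⟨A, hA, hd, hR⟩ := H
  refine ⟨fun i => h • A i, fun i => (hA i).smul hh.ne', fun i j hij => ?_, fun i => ?_⟩
  · simp only [interior_smul₀ hh.ne']
    exact (disjoint_image_iff (smul_right_injective _ hh.ne')).2 (hd hij)
  · have := smul_set_mono (a := h) (hR i)
    rwa [_root_.smul_closedBall' hh.ne', smul_zero, Real.norm_of_nonneg hh.le] at this

theorem PacksBall.card_le {R r : ℝ} {n : ℕ} (hr : 0 < r) (hR : 0 ≤ R) {p : Euc d}
    (hp : closedBall p r ⊆ K) (H : PacksBall K R n) : (n : ℝ) * r ^ d ≤ R ^ d := by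
  obtain ⟨A, hA, hd, hAR⟩ := H
  choose c hc using fun i => (hA i).exists_closedBall_subset hp
  have := card_mul_pow_le_of_disjoint_balls Finset.univ c hr hR
    (fun i _ j _ hij => (hd hij).mono
      (interior_maximal (ball_subset_closedBall.trans (hc i)) isOpen_ball)
      (interior_maximal (ball_subset_closedBall.trans (hc j)) isOpen_ball))
    fun i _ => ball_subset_closedBall.trans ((hc i).trans (hAR i))
  simpa using this

theorem disjoint_closedBall_of_separated {X : Finset (Euc d)} {ρ : ℝ}
    (hsep : (X : Set (Euc d)).Pairwise fun x y => 2 * ρ < dist x y) {x y : X} (hxy : x ≠ y) :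
    Disjoint (closedBall (x : Euc d) ρ) (closedBall (y : Euc d) ρ) :=
  closedBall_disjoint_closedBall (by
    linarith [hsep x.2 y.2 (fun h => hxy (Subtype.ext h))])

theorem card_subtype_forall_notMem {n : ℕ} {κ : Type*} [Fintype κ] (D : κ → Finset (Fin n))
    (hD : Pairwise fun x y => Disjoint (D x) (D y)) :
    Fintype.card {i : Fin n // ∀ x, i ∉ D x} + ∑ x, (D x).card = n := by
  classical
  have h := Fintype.card_subtype_compl fun i : Fin n => ∃ x, i ∈ D x
  have h2 : Fintype.card {i : Fin n // ∃ x, i ∈ D x} = ∑ x, (D x).card := by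
    rw [Fintype.card_subtype, ← Finset.card_biUnion fun x _ y _ hxy => hD hxy]
    congr 1
    ext i
    simp
  have h3 := Fintype.card_subtype_le fun i : Fin n => ∃ x, i ∈ D x
  simp only [not_exists, Fintype.card_fin] at h h3
  convert_to Fintype.card {i : Fin n // ∀ x, i ∉ D x} + _ = n
  rw [h, h2] at *
  omega

/-- Simultaneous improvements at separated points enlarge a packing of smaller copies. -/
theorem PacksBall.of_improvable {n : ℕ} {A : Fin n → Set (Euc d)} {R ρ : ℝ}
    (hK : (interior K).Nonempty) (hA : ∀ i, IsReplica K (A i))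
    (hd : Pairwise fun i j => Disjoint (interior (A i)) (interior (A j)))
    (hR : ∀ i, A i ⊆ closedBall 0 R)
    (hQ : ∀ L, IsReplica K L → ∃ T, IsReplica Q T ∧ T ⊆ L)
    (X : Finset (Euc d)) (hsep : (X : Set (Euc d)).Pairwise fun x y => 2 * ρ < dist x y)
    (hX : ∀ x ∈ X, closedBall x ρ ⊆ closedBall 0 R ∧ ImprovablePacking A Q x ρ) :
    ∃ n', n + X.card ≤ n' ∧ PacksBall Q R n' := by
  choose B hB hBA using fun i => hQ (A i) (hA i)
  choose D k T hk hD hT hTb hTd hTA using fun x : X => (hX x x.2).2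
  have hDd : Pairwise fun x y => Disjoint (D x) (D y) := by
    intro x y hxy
    rw [Finset.disjoint_left]
    intro i hix hiy
    obtain ⟨z, hz⟩ := (hA i).interior_nonempty hK
    exact (disjoint_closedBall_of_separated hsep hxy).le_bot
      ⟨hD x i hix (interior_subset hz), hD y i hiy (interior_subset hz)⟩
  refine ⟨_, ?_, PacksBall.of_fintype (ι := {i : Fin n // ∀ x, i ∉ D x} ⊕ (Σ x : X, Fin (k x)))
    (Sum.elim (fun i => B i) fun p => T p.1 p.2) ?_ ?_ ?_⟩
  · have h1 := card_subtype_forall_notMem D hDd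
    have h2 : ∑ x : X, ((D x).card + 1) ≤ ∑ x : X, k x := Finset.sum_le_sum fun x _ => hk x
    simp only [Finset.sum_add_distrib, Finset.sum_const, Finset.card_univ, Fintype.card_coe,
      smul_eq_mul, mul_one] at h2
    simp only [Fintype.card_sum, Fintype.card_sigma, Fintype.card_fin]
    omega
  · rintro (i | p)
    · exact hB i
    · exact hT _ _
  · rintro (i | ⟨x, i⟩) (j | ⟨y, j⟩) hij
    · exact (hd fun h => hij (by rw [Subtype.ext h])).mono (interior_mono (hBA i))
        (interior_mono (hBA j))
    · exact ((hTA y j i (i.2 y)).mono_right (interior_mono (hBA i))).symm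
    · exact (hTA x i j (j.2 x)).mono_right (interior_mono (hBA j))
    · obtain rfl | hxy := eq_or_ne x y
      · exact hTd x fun h : i = j => hij (by rw [h])
      · exact (disjoint_closedBall_of_separated hsep hxy).mono (interior_subset.trans (hTb x i))
          (interior_subset.trans (hTb y j))
  · rintro (i | p)
    · exact (hBA i).trans (hR i)
    · exact (hTb _ _).trans (hX _ p.1.2).1

/-- Finite packings that cannot be improved near the origin, not even by slightly smaller copies
of `K`. -/
theorem exists_unimprovable_packings (hK : IsBody K) (hsim : StrictNestedSimilarity K) :
    ∃ s : ℕ → ℝ, (∀ m, 0 < s m ∧ s m < 1) ∧ ∀ M : ℕ, ∃ n, 0 < n ∧ ∃ g : Fin n → Euc d ≃ᵢ Euc d,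
      (Pairwise fun i j => Disjoint (interior (g i '' K)) (interior (g j '' K))) ∧
      ∀ m < M, ¬ ImprovablePacking (fun i => g i '' K) (s m • K) 0 (m + 1) := by
  obtain ⟨p, r, hr, hp⟩ := hK.exists_closedBall_subset
  obtain ⟨b, hb⟩ := hK.2.1.isBounded.subset_closedBall (0 : Euc d)
  let S : ℝ → Set ℕ := fun R => {n | PacksBall K R n}
  have hle : ∀ R, 0 ≤ R → ∀ n ∈ S R, (n : ℝ) ≤ (r ^ d)⁻¹ * R ^ d := fun R hR n hn => by
    rw [inv_mul_eq_div, le_div_iff₀ (by positivity)]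
    exact PacksBall.card_le hr hR hp hn
  have hne : ∀ R, (S R).Nonempty := fun R => ⟨0, Fin.elim0, fun i => i.elim0, fun i => i.elim0,
    fun i => i.elim0⟩
  have hbdd : ∀ R, 0 ≤ R → BddAbove (S R) := fun R hR =>
    ⟨_, fun n hn => Nat.le_floor (hle R hR n hn)⟩
  obtain ⟨h, hh1, H⟩ := exists_good_center (d := d) (F := fun R => ((sSup (S R) : ℕ) : ℝ))
    (C := (r ^ d)⁻¹) (fun R hR => by
      rw [abs_of_nonneg (Nat.cast_nonneg _)]
      have hR0 : 0 ≤ R := zero_le_one.trans hR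
      exact hle R hR0 _ (Nat.sSup_mem (hne R) (hbdd R hR0)))
    (s := Ioi 1) inferInstance (fun x hx => one_pos.trans hx)
  have hh0 : ∀ m, 0 < h m := fun m => one_pos.trans (hh1 m)
  have hs : ∀ m, 0 < (h m)⁻¹ ∧ (h m)⁻¹ < 1 := fun m =>
    ⟨inv_pos.2 (hh0 m), inv_lt_one_of_one_lt₀ (hh1 m)⟩
  refine ⟨fun m => (h m)⁻¹, hs, fun M => ?_⟩
  obtain ⟨R, hbR, hMR, H⟩ := H M b
  have hR0 : 0 ≤ R := (Nat.cast_nonneg M).trans hMR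
  obtain ⟨A, hA, hd, hAR⟩ : PacksBall K R (sSup (S R)) := Nat.sSup_mem (hne R) (hbdd R hR0)
  obtain ⟨x, -, hx⟩ := H (fun m x => ImprovablePacking A ((h m)⁻¹ • K) x (m + 1)) (by
    intro m hm X hX hsep
    obtain ⟨n', hn', hP⟩ := PacksBall.of_improvable hK.interior_nonempty hA hd hAR
      (fun L hL => by
        obtain ⟨T, hT, hTL⟩ := hsim.exists_subset_interior (hs m).1 (hs m).2 hL
        exact ⟨T, hT, hTL.trans interior_subset⟩) X hsep fun x hx => by
        refine ⟨closedBall_subset_closedBall' ?_, (hX x hx).2⟩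
        have h1 := mem_closedBall.1 (hX x hx).1
        have h2 : (m : ℝ) + 1 ≤ M := by exact_mod_cast hm
        linarith
    have hP' := hP.smul (hh0 m)
    rw [smul_inv_smul₀ (hh0 m).ne'] at hP'
    exact_mod_cast hn'.trans (le_csSup (hbdd _ (mul_nonneg (hh0 m).le hR0)) hP'))
  have hpos : 0 < sSup (S R) := by
    have : (1 : ℕ) ∈ S R := ⟨fun _ => K, fun _ => .refl K,
      fun i j hij => (hij (Subsingleton.elim i j)).elim,
      fun _ => hb.trans (closedBall_subset_closedBall hbR)⟩
    exact le_csSup (hbdd R hR0) this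
  choose g hg using hA
  let e : Euc d ≃ᵢ Euc d := IsometryEquiv.subRight x
  refine ⟨_, hpos, fun i => (g i).trans e, fun i j hij => ?_, fun m hm hI => hx m hm ?_⟩
  · simp only [image_trans_isometryEquiv, hg]
    simp only [interior_image_isometryEquiv]
    exact (disjoint_image_iff e.injective).2 (hd hij)
  · have hA' : ∀ i, e.symm '' ((g i).trans e '' K) = A i := fun i => by
      rw [image_trans_isometryEquiv, hg]
      exact e.toEquiv.symm_image_image (A i)
    have he : e.symm 0 = x := by simp [e]
    simpa only [hA', he] using hI.image e.symm

end Packing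

section Covering

variable {d : ℕ} {K Q : Set (Euc d)}

/-- `n` replicas of `K` can cover the ball of radius `R`. -/
def CoversBall {d : ℕ} (K : Set (Euc d)) (R : ℝ) (n : ℕ) : Prop :=
  ∃ A : Fin n → Set (Euc d), (∀ i, IsReplica K (A i)) ∧ closedBall 0 R ⊆ ⋃ i, A i

/-- Some members of the family `A` whose enlargements in `A'` lie in a ball can be replaced by a
smaller number of replicas of `Q`, provided that the remaining members are enlarged. -/
def ReducibleCovering {d : ℕ} {ι : Type*} (A A' : ι → Set (Euc d)) (Q : Set (Euc d)) (x : Euc d)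
    (ρ : ℝ) : Prop :=
  ∃ (D : Finset ι) (k : ℕ) (T : Fin k → Set (Euc d)), k < D.card ∧
    (∀ i ∈ D, A' i ⊆ closedBall x ρ) ∧ (∀ j, IsReplica Q (T j)) ∧
    ∀ i ∈ D, A i ⊆ (⋃ j, T j) ∪ ⋃ i' ∉ D, A' i'

theorem ReducibleCovering.image {ι : Type*} {A A' : ι → Set (Euc d)} {x : Euc d} {ρ : ℝ}
    (h : ReducibleCovering A A' Q x ρ) (e : Euc d ≃ᵢ Euc d) :
    ReducibleCovering (fun i => e '' A i) (fun i => e '' A' i) Q (e x) ρ := by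
  obtain ⟨D, k, T, hk, hD, hT, hA⟩ := h
  refine ⟨D, k, fun j => e '' T j, hk, fun i hi => ?_, fun j => (hT j).image e, fun i hi => ?_⟩
  · rw [← e.image_closedBall]; exact image_mono (hD i hi)
  · simp only [← image_iUnion, ← image_union]
    exact image_mono (hA i hi)

theorem CoversBall.of_fintype {ι : Type*} [Fintype ι] {R : ℝ} (A : ι → Set (Euc d))
    (hA : ∀ i, IsReplica K (A i)) (hR : closedBall 0 R ⊆ ⋃ i, A i) :
    CoversBall K R (Fintype.card ι) :=
  ⟨A ∘ (Fintype.equivFin ι).symm, fun _ => hA _, by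
    rwa [← (Fintype.equivFin ι).symm.surjective.iUnion_comp A] at hR⟩

theorem CoversBall.smul {R h : ℝ} {n : ℕ} (hh : 0 < h) (H : CoversBall K R n) :
    CoversBall (h • K) (h * R) n := by
  obtain ⟨A, hA, hR⟩ := H
  refine ⟨fun i => h • A i, fun i => (hA i).smul hh.ne', ?_⟩
  have := smul_set_mono (a := h) hR
  rwa [_root_.smul_closedBall' hh.ne', smul_zero, Real.norm_of_nonneg hh.le, smul_set_iUnion] at this

theorem exists_coversBall {R r : ℝ} (hr : 0 < r) (hR : 0 ≤ R) {p : Euc d}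
    (hp : closedBall p r ⊆ K) : ∃ n, CoversBall K R n ∧ (n : ℝ) * (r / 2) ^ d ≤ (R + r / 2) ^ d := by
  obtain ⟨X, hX, hsep, hcov⟩ := exists_maximal_separated (closedBall (0 : Euc d) R) hr hR Subset.rfl
  refine ⟨X.card, ?_, card_mul_pow_le_of_separated X hr hR hsep hX⟩
  rw [← Fintype.card_coe]
  refine CoversBall.of_fintype (fun x : X => IsometryEquiv.addRight ((x : Euc d) - p) '' K)
    (fun x => (IsReplica.refl K).image _) fun y hy => ?_
  obtain ⟨x, hx, hxy⟩ := hcov y hy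
  refine mem_iUnion.2 ⟨⟨x, hx⟩, y - (x - p), hp ?_, by simp⟩
  rw [dist_eq_norm] at hxy
  rw [mem_closedBall, dist_eq_norm]
  convert hxy using 2
  abel

/-- Simultaneous reductions at separated points lead to a smaller covering by larger copies. -/
theorem CoversBall.of_reducible {n : ℕ} {A A' : Fin n → Set (Euc d)} {R ρ : ℝ}
    (hK : K.Nonempty) (hA : ∀ i, IsReplica K (A i)) (hR : closedBall 0 R ⊆ ⋃ i, A i)
    (hA' : ∀ i, IsReplica Q (A' i)) (hAA' : ∀ i, A i ⊆ A' i)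
    (X : Finset (Euc d)) (hsep : (X : Set (Euc d)).Pairwise fun x y => 2 * ρ < dist x y)
    (hX : ∀ x ∈ X, ReducibleCovering A A' Q x ρ) :
    ∃ n', n' + X.card ≤ n ∧ CoversBall Q R n' := by
  choose D k T hk hD hT hTA using fun x : X => hX x x.2
  have hmeet : ∀ x y : X, ∀ i ∈ D x, ∀ z ∈ A' i, ∀ j ∈ D y, z ∈ A' j → x = y := by
    intro x y i hi z hzi j hj hzj
    by_contra hxy
    exact (disjoint_closedBall_of_separated hsep hxy).le_bot ⟨hD x i hi hzi, hD y j hj hzj⟩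
  have hDd : Pairwise fun x y => Disjoint (D x) (D y) := by
    intro x y hxy
    rw [Finset.disjoint_left]
    intro i hix hiy
    obtain ⟨f, hf⟩ := hA i
    obtain ⟨z, hz⟩ : (A i).Nonempty := hf ▸ hK.image f
    exact hxy (hmeet x y i hix z (hAA' i hz) i hiy (hAA' i hz))
  refine ⟨_, ?_, CoversBall.of_fintype (ι := {i : Fin n // ∀ x, i ∉ D x} ⊕ (Σ x : X, Fin (k x)))
    (Sum.elim (fun i => A' i) fun p => T p.1 p.2) ?_ fun y hy => ?_⟩
  · have h1 := card_subtype_forall_notMem D hDd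
    have h2 : ∑ x : X, (k x + 1) ≤ ∑ x : X, (D x).card := Finset.sum_le_sum fun x _ => hk x
    simp only [Finset.sum_add_distrib, Finset.sum_const, Finset.card_univ, Fintype.card_coe,
      smul_eq_mul, mul_one] at h2
    simp only [Fintype.card_sum, Fintype.card_sigma, Fintype.card_fin]
    omega
  · rintro (i | p)
    · exact hA' i
    · exact hT _ _
  · obtain ⟨i, hi⟩ := mem_iUnion.1 (hR hy)
    by_cases hiD : ∀ x, i ∉ D x
    · exact mem_iUnion.2 ⟨.inl ⟨i, hiD⟩, hAA' i hi⟩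
    push Not at hiD
    obtain ⟨x, hx⟩ := hiD
    obtain h | h := hTA x i hx hi
    · obtain ⟨j, hj⟩ := mem_iUnion.1 h
      exact mem_iUnion.2 ⟨.inr ⟨x, j⟩, hj⟩
    · simp only [mem_iUnion] at h
      obtain ⟨i', hi', hy'⟩ := h
      refine mem_iUnion.2 ⟨.inl ⟨i', fun x' hx' => ?_⟩, hy'⟩
      obtain rfl := hmeet x x' i hx y (hAA' i hi) i' hx' hy'
      exact hi' hx'

/-- Finite coverings of large balls that cannot be reduced near the origin, not even by slightly
larger copies of `K`. -/
theorem exists_irreducible_coverings (hK : IsBody K) (hsim : StrictNestedSimilarity K) :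
    ∃ s : ℕ → ℝ, ∃ Q : ℕ → Set (Euc d), (∀ m, 1 < s m ∧ s m < 2) ∧
      (∀ m, IsReplica (s m • K) (Q m) ∧ K ⊆ interior (Q m)) ∧
      ∀ M : ℕ, ∃ n, 0 < n ∧ ∃ g : Fin n → Euc d ≃ᵢ Euc d,
        closedBall 0 M ⊆ ⋃ i, g i '' K ∧
        ∀ m < M, ¬ ReducibleCovering (fun i => g i '' K) (fun i => g i '' Q m) (Q m) 0 (m + 1) := by
  obtain ⟨p, r, hr, hp⟩ := hK.exists_closedBall_subset
  let S : ℝ → Set ℕ := fun R => {n | CoversBall K R n}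
  have hne : ∀ R, 0 ≤ R → (S R).Nonempty := fun R hR =>
    (exists_coversBall hr hR hp).imp fun _ h => h.1
  have hle : ∀ R, 0 ≤ R → ((sInf (S R) : ℕ) : ℝ) * (r / 2) ^ d ≤ (R + r / 2) ^ d := fun R hR => by
    obtain ⟨n, hn, hnR⟩ := exists_coversBall hr hR hp
    exact (mul_le_mul_of_nonneg_right (Nat.cast_le.2 (Nat.sInf_le hn)) (by positivity)).trans hnR
  have hIoo : (𝓝[Ioo (1 / 2) 1] (1 : ℝ)).NeBot := by
    rw [nhdsWithin_Ioo_eq_nhdsLT (by norm_num)]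
    infer_instance
  obtain ⟨h, hh1, H⟩ := exists_good_center (d := d) (F := fun R => -((sInf (S R) : ℕ) : ℝ))
    (C := ((1 + r / 2) / (r / 2)) ^ d) (fun R hR => by
      rw [abs_neg, abs_of_nonneg (Nat.cast_nonneg _), div_pow, div_mul_eq_mul_div,
        le_div_iff₀ (by positivity), ← mul_pow]
      refine (hle R (zero_le_one.trans hR)).trans ?_
      gcongr
      nlinarith)
    (s := Ioo (1 / 2) 1) hIoo (fun x hx => one_half_pos.trans hx.1)
  have hh0 : ∀ m, 0 < h m := fun m => one_half_pos.trans (hh1 m).1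
  have hs : ∀ m, 1 < (h m)⁻¹ ∧ (h m)⁻¹ < 2 := fun m =>
    ⟨(one_lt_inv₀ (hh0 m)).2 (hh1 m).2, by
      rw [inv_lt_comm₀ (hh0 m) two_pos, ← one_div]; exact (hh1 m).1⟩
  choose Q hQ hKQ using fun m => hsim.exists_superset (hs m).1
  refine ⟨fun m => (h m)⁻¹, Q, hs, fun m => ⟨hQ m, hKQ m⟩, fun M => ?_⟩
  obtain ⟨R, -, hMR, H⟩ := H M 0
  have hR0 : 0 ≤ R := (Nat.cast_nonneg M).trans hMR
  obtain ⟨A, hA, hAR⟩ : CoversBall K R (sInf (S R)) := Nat.sInf_mem (hne R hR0)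
  choose g hg using hA
  obtain rfl : (fun i => g i '' K) = A := funext hg
  obtain ⟨x, hxR, hx⟩ := H (fun m x => ReducibleCovering (fun i => g i '' K)
      (fun i => g i '' Q m) (Q m) x (m + 1)) (by
    intro m hm X hX hsep
    obtain ⟨n', hn', hP⟩ := CoversBall.of_reducible hK.1 (fun i => ⟨g i, rfl⟩) hAR
      (fun i => ⟨g i, rfl⟩) (fun i => image_mono ((hKQ m).trans interior_subset)) X hsep
      fun x hx => (hX x hx).2
    have hP' : CoversBall ((h m)⁻¹ • K) R n' := by
      obtain ⟨B, hB, hBR⟩ := hP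
      exact ⟨B, fun i => (hQ m).trans (hB i), hBR⟩
    have hP' := hP'.smul (hh0 m)
    rw [smul_inv_smul₀ (hh0 m).ne'] at hP'
    have h1 : sInf (S (h m * R)) ≤ n' := Nat.sInf_le hP'
    have h2 : sInf (S (h m * R)) + X.card ≤ sInf (S R) := by omega
    have h3 : ((sInf (S (h m * R)) : ℕ) : ℝ) + X.card ≤ (sInf (S R) : ℕ) := by exact_mod_cast h2
    linarith)
  have hpos : 0 < sInf (S R) := by
    obtain ⟨i, -⟩ := mem_iUnion.1 (hAR (mem_closedBall_self hR0))
    exact i.pos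
  let e : Euc d ≃ᵢ Euc d := IsometryEquiv.subRight x
  have he : e.symm 0 = x := by simp [e]
  have hback : ∀ i L, e.symm '' ((g i).trans e '' L) = g i '' L := fun i L => by
    rw [image_trans_isometryEquiv]
    exact e.toEquiv.symm_image_image _
  refine ⟨_, hpos, fun i => (g i).trans e, fun y hy => ?_, fun m hm hI => hx m hm ?_⟩
  · have hy' : e.symm y ∈ closedBall (0 : Euc d) R := by
      have h1 := dist_triangle (e.symm y) (e.symm 0) 0
      rw [e.symm.dist_eq, he] at h1
      rw [mem_closedBall] at hy hxR ⊢
      linarith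
    obtain ⟨i, z, hz, hzy⟩ := mem_iUnion.1 (hAR hy')
    exact mem_iUnion.2 ⟨i, z, hz, (congrArg e hzy).trans (e.apply_symm_apply y)⟩
  · simpa only [hback, he] using hI.image e.symm

end Covering

section Limits

variable {d : ℕ} {K : Set (Euc d)} {U : Ultrafilter ℕ}

theorem exists_tendsto_of_eventually_mem_closedBall {y : ℕ → Euc d} {B : ℝ}
    (h : ∀ᶠ M in (U : Filter ℕ), y M ∈ closedBall 0 B) : ∃ y₀, Tendsto y U (𝓝 y₀) := by
  obtain ⟨y₀, -, hy₀⟩ := (isCompact_closedBall (0 : Euc d) B).ultrafilter_le_nhds (U.map y)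
    (le_principal_iff.2 h)
  exact ⟨y₀, hy₀⟩

theorem tendsto_symm_apply {γ : ℕ → Euc d ≃ᵢ Euc d} {g : Euc d ≃ᵢ Euc d} {l : Filter ℕ}
    (h : ∀ x, Tendsto (fun M => γ M x) l (𝓝 (g x))) {y : ℕ → Euc d} {y₀ : Euc d}
    (hy : Tendsto y l (𝓝 y₀)) : Tendsto (fun M => (γ M).symm (y M)) l (𝓝 (g.symm y₀)) := by
  rw [tendsto_iff_dist_tendsto_zero]
  have h1 : Tendsto (fun M => dist (y M) (γ M (g.symm y₀))) l (𝓝 0) := by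
    simpa using hy.dist (h (g.symm y₀))
  refine h1.congr fun M => ?_
  rw [← (γ M).dist_eq ((γ M).symm (y M)), (γ M).apply_symm_apply]

theorem exists_isometryEquiv_limit {γ : ℕ → Euc d ≃ᵢ Euc d} {B : ℝ}
    (h : ∀ᶠ M in (U : Filter ℕ), ‖γ M 0‖ ≤ B) :
    ∃ g : Euc d ≃ᵢ Euc d, ∀ x, Tendsto (fun M => γ M x) U (𝓝 (g x)) := by
  have hf : ∀ x, ∃ y, Tendsto (fun M => γ M x) U (𝓝 y) := fun x => by
    refine exists_tendsto_of_eventually_mem_closedBall (B := ‖x‖ + B) (h.mono fun M hM => ?_)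
    have h1 := dist_triangle (γ M x) (γ M 0) 0
    rw [(γ M).dist_eq, dist_zero_right x, dist_zero_right (γ M 0)] at h1
    rw [mem_closedBall]
    linarith
  have hg : ∀ x, ∃ y, Tendsto (fun M => (γ M).symm x) U (𝓝 y) := fun x => by
    refine exists_tendsto_of_eventually_mem_closedBall (B := ‖x‖ + B) (h.mono fun M hM => ?_)
    rw [mem_closedBall, ← (γ M).dist_eq, (γ M).apply_symm_apply, dist_eq_norm]
    exact (norm_sub_le _ _).trans (by linarith)
  choose f hf using hf
  choose f' hf' using hg
  have hiso : Isometry f := Isometry.of_dist_eq fun x y => by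
    refine tendsto_nhds_unique ((hf x).dist (hf y)) ?_
    simp only [(γ _).dist_eq, tendsto_const_nhds]
  have hinv : ∀ x, f (f' x) = x := fun x => by
    refine tendsto_nhds_unique (hf (f' x)) ?_
    rw [tendsto_iff_dist_tendsto_zero]
    have h1 : Tendsto (fun M => dist (f' x) ((γ M).symm x)) U (𝓝 0) := by
      simpa using (tendsto_const_nhds (x := f' x)).dist (hf' x)
    refine h1.congr fun M => ?_
    rw [← (γ M).dist_eq, (γ M).apply_symm_apply]
  exact ⟨IsometryEquiv.mk' f f' hinv hiso, hf⟩

theorem eventually_mem_image {γ : ℕ → Euc d ≃ᵢ Euc d} {g : Euc d ≃ᵢ Euc d}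
    (h : ∀ x, Tendsto (fun M => γ M x) U (𝓝 (g x))) {y : ℕ → Euc d} {y₀ : Euc d}
    (hy : Tendsto y U (𝓝 y₀)) {O : Set (Euc d)} (hO : IsOpen O) (hy₀ : y₀ ∈ g '' O) :
    ∀ᶠ M in (U : Filter ℕ), y M ∈ γ M '' O := by
  simp only [← IsometryEquiv.preimage_symm] at hy₀ ⊢
  exact (tendsto_symm_apply h hy).eventually (hO.mem_nhds hy₀)

theorem mem_image_of_eventually {γ : ℕ → Euc d ≃ᵢ Euc d} {g : Euc d ≃ᵢ Euc d}
    (h : ∀ x, Tendsto (fun M => γ M x) U (𝓝 (g x))) {y : ℕ → Euc d} {y₀ : Euc d}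
    (hy : Tendsto y U (𝓝 y₀)) (hK : IsClosed K) (hyK : ∀ᶠ M in (U : Filter ℕ), y M ∈ γ M '' K) :
    y₀ ∈ g '' K := by
  simp only [← IsometryEquiv.preimage_symm] at hyK ⊢
  exact hK.mem_of_tendsto (tendsto_symm_apply h hy) hyK

/-- The members of the limit along `U` of a sequence of finite families of replicas of `K`. -/
def limitReplicas {d : ℕ} (K : Set (Euc d)) (U : Ultrafilter ℕ) {n : ℕ → ℕ}
    (G : ∀ M, Fin (n M) → Euc d ≃ᵢ Euc d) : Set (Set (Euc d)) :=
  {L | ∃ (i : ∀ M, Fin (n M)) (g : Euc d ≃ᵢ Euc d),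
    (∀ x, Tendsto (fun M => G M (i M) x) U (𝓝 (g x))) ∧ g '' K = L}

variable {n : ℕ → ℕ} {G : ∀ M, Fin (n M) → Euc d ≃ᵢ Euc d}

theorem isometryEquiv_limit_unique {i j : ∀ M, Fin (n M)} {g g' : Euc d ≃ᵢ Euc d}
    (hg : ∀ x, Tendsto (fun M => G M (i M) x) U (𝓝 (g x)))
    (hg' : ∀ x, Tendsto (fun M => G M (j M) x) U (𝓝 (g' x)))
    (hij : ∀ᶠ M in (U : Filter ℕ), i M = j M) : g = g' := by
  ext1 x
  exact tendsto_nhds_unique (hg x)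
    ((hg' x).congr' (hij.mono fun M hM => by simp only [hM]))

/-- Members that eventually meet a fixed ball have a limit. -/
theorem exists_limit_of_eventually_exists (hn : ∀ M, 0 < n M) (hK : IsCompact K) {B : ℝ}
    {p : ∀ M, Fin (n M) → Euc d → Prop}
    (h : ∀ᶠ M in (U : Filter ℕ), ∃ i, ∃ y ∈ G M i '' K, y ∈ closedBall 0 B ∧ p M i y) :
    ∃ (i : ∀ M, Fin (n M)) (g : Euc d ≃ᵢ Euc d) (y : ℕ → Euc d) (y₀ : Euc d),
      (∀ x, Tendsto (fun M => G M (i M) x) U (𝓝 (g x))) ∧ Tendsto y U (𝓝 y₀) ∧ y₀ ∈ g '' K ∧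
      ∀ᶠ M in (U : Filter ℕ), p M (i M) (y M) := by
  have h' : ∀ M, ∃ i : Fin (n M), ∃ y,
      (∃ i, ∃ y ∈ G M i '' K, y ∈ closedBall 0 B ∧ p M i y) →
        y ∈ G M i '' K ∧ y ∈ closedBall 0 B ∧ p M i y := fun M => by
    by_cases hM : ∃ i, ∃ y ∈ G M i '' K, y ∈ closedBall 0 B ∧ p M i y
    · obtain ⟨i, y, hy⟩ := hM
      exact ⟨i, y, fun _ => hy⟩
    · exact ⟨⟨0, hn M⟩, 0, fun H => (hM H).elim⟩
  choose i y hiy using h'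
  have hiy : ∀ᶠ M in (U : Filter ℕ), y M ∈ G M (i M) '' K ∧ y M ∈ closedBall 0 B ∧
    p M (i M) (y M) := h.mono fun M hM => hiy M hM
  obtain ⟨b, hb⟩ := hK.isBounded.subset_closedBall (0 : Euc d)
  obtain ⟨g, hg⟩ := exists_isometryEquiv_limit (U := U) (γ := fun M => G M (i M)) (B := b + B)
    (hiy.mono fun M ⟨⟨z, hz, hzy⟩, hyB, _⟩ => by
      have h1 := dist_triangle (G M (i M) 0) (G M (i M) z) 0
      rw [(G M (i M)).dist_eq, dist_zero_right, dist_comm, hzy] at h1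
      exact h1.trans (add_le_add (hb hz) hyB))
  obtain ⟨y₀, hy₀⟩ := exists_tendsto_of_eventually_mem_closedBall (hiy.mono fun M hM => hM.2.1)
  exact ⟨i, g, y, y₀, hg, hy₀, mem_image_of_eventually hg hy₀ hK.isClosed
    (hiy.mono fun M hM => hM.1), hiy.mono fun M hM => hM.2.2⟩

theorem isReplica_of_mem_limitReplicas {L : Set (Euc d)} (hL : L ∈ limitReplicas K U G) :
    IsReplica K L := by
  obtain ⟨i, g, -, hg⟩ := hL
  exact ⟨g, hg⟩

/-- The finitely many limit members `S` come from members whose images of the origin stay in a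
common ball. -/
theorem exists_forall_eventually_norm_le {ι : Type*} [Finite ι] {i : ι → ∀ M, Fin (n M)}
    {g : ι → Euc d ≃ᵢ Euc d} (hg : ∀ s x, Tendsto (fun M => G M (i s M) x) U (𝓝 (g s x))) :
    ∃ B, ∀ᶠ M in (U : Filter ℕ), ∀ s, ‖G M (i s M) 0‖ ≤ B := by
  obtain ⟨B, hB⟩ := (Set.finite_range fun s => ‖g s 0‖).bddAbove
  refine ⟨B + 1, eventually_all.2 fun s => ?_⟩
  refine ((hg s 0).norm.eventually (gt_mem_nhds (lt_add_one _))).mono fun M hM => ?_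
  linarith [hB (mem_range_self s)]

theorem eventually_eq_of_interior_meet
    (hd : ∀ M, Pairwise fun i j => Disjoint (interior (G M i '' K)) (interior (G M j '' K)))
    {i j : ∀ M, Fin (n M)} {g g' : Euc d ≃ᵢ Euc d}
    (hg : ∀ x, Tendsto (fun M => G M (i M) x) U (𝓝 (g x)))
    (hg' : ∀ x, Tendsto (fun M => G M (j M) x) U (𝓝 (g' x)))
    (h : ¬ Disjoint (interior (g '' K)) (interior (g' '' K))) :
    ∀ᶠ M in (U : Filter ℕ), i M = j M := by
  obtain ⟨y, hy, hy'⟩ := not_disjoint_iff.1 h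
  rw [interior_image_isometryEquiv] at hy hy'
  filter_upwards [eventually_mem_image hg tendsto_const_nhds isOpen_interior hy,
    eventually_mem_image hg' tendsto_const_nhds isOpen_interior hy'] with M hM hM'
  by_contra hne
  rw [← interior_image_isometryEquiv] at hM hM'
  exact (hd M hne).le_bot ⟨hM, hM'⟩

theorem isPacking_limitReplicas
    (hd : ∀ M, Pairwise fun i j => Disjoint (interior (G M i '' K)) (interior (G M j '' K))) :
    IsPacking K (limitReplicas K U G) := by
  refine ⟨fun L hL => isReplica_of_mem_limitReplicas hL, ?_⟩
  rintro _ ⟨i, g, hg, rfl⟩ _ ⟨j, g', hg', rfl⟩ hne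
  by_contra h
  exact hne (by
    rw [isometryEquiv_limit_unique hg hg' (eventually_eq_of_interior_meet hd hg hg' h)])

theorem IsReplica.eq_closure_interior {L : Set (Euc d)} (hK : IsBody K) (hL : IsReplica K L) :
    L = closure (interior L) := by
  obtain ⟨f, rfl⟩ := hL
  rw [interior_image_isometryEquiv]
  exact (congrArg (f '' ·) hK.2.2.2).trans (f.toHomeomorph.image_closure _)

theorem exists_isCompletelySaturated (hK : IsBody K) (hsim : StrictNestedSimilarity K) :
    ∃ P : Set (Set (Euc d)), IsPacking K P ∧ IsCompletelySaturated K P := by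
  classical
  obtain ⟨s, hs, H⟩ := exists_unimprovable_packings hK hsim
  choose n hn G hd hG using H
  let U : Ultrafilter ℕ := hyperfilter ℕ
  refine ⟨limitReplicas K U G, isPacking_limitReplicas hd, fun k hk => ?_⟩
  rintro ⟨S, L, hSP, hSfin, hScard, hL, hLd, hLP⟩
  have := hSfin.fintype
  choose i g hg hgS using fun A : S => hSP A.2
  obtain ⟨B, hB⟩ := exists_forall_eventually_norm_le (U := U) hg
  obtain ⟨b, hb⟩ := hK.2.1.isBounded.subset_closedBall (0 : Euc d)
  obtain ⟨B', hB'⟩ := (isCompact_iUnion fun j => (hL j).isCompact hK.2.1).isBounded.subset_closedBall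
    (0 : Euc d)
  obtain ⟨m, hm⟩ := exists_nat_ge (max B' (B + b))
  choose T hT hTL using fun j => hsim.exists_subset_interior (hs m).1 (hs m).2 (hL j)
  let D : ∀ M, Finset (Fin (n M)) := fun M => Finset.univ.image fun A : S => i A M
  have hTball : ∀ j, T j ⊆ closedBall 0 (m + 1) := fun j =>
    ((hTL j).trans interior_subset).trans <| ((subset_iUnion L j).trans hB').trans <|
      closedBall_subset_closedBall (by linarith [(le_max_left B' (B + b)).trans hm])
  have hmeet : ∀ j, ∀ᶠ M in (U : Filter ℕ), ∀ i' ∉ D M,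
      Disjoint (interior (T j)) (interior (G M i' '' K)) := by
    intro j
    by_contra hcon
    rw [← Ultrafilter.eventually_not] at hcon
    obtain ⟨i', g', y, y₀, hg', hy, hy₀, hp⟩ := exists_limit_of_eventually_exists (K := K) (G := G)
      (U := U) hn hK.2.1 (B := m + 1) (p := fun M i' y => i' ∉ D M ∧ y ∈ T j)
      (hcon.mono fun M hM => by
        push Not at hM
        obtain ⟨i', hi', hdis⟩ := hM
        obtain ⟨y, hyT, hyG⟩ := Set.not_disjoint_iff.1 hdis
        exact ⟨i', y, interior_subset hyG, hTball j (interior_subset hyT), hi',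
          interior_subset hyT⟩)
    have hTcl : IsClosed (T j) :=
      ((hT j).isCompact (hK.2.1.smul (s m))).isClosed
    have hy₀L : y₀ ∈ interior (L j) := hTL j (hTcl.mem_of_tendsto hy (hp.mono fun M hM => hM.2))
    by_cases hS : g' '' K ∈ S
    · have hint : ¬ Disjoint (interior (g' '' K)) (interior (g ⟨_, hS⟩ '' K)) := by
        rw [hgS ⟨_, hS⟩, disjoint_self]
        exact ((IsReplica.interior_nonempty ⟨g', rfl⟩ hK.interior_nonempty)).ne_empty
      obtain ⟨M, hM, hM'⟩ := (hp.and (eventually_eq_of_interior_meet hd hg' (hg _) hint)).exists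
      exact hM.1 (Finset.mem_image.2 ⟨_, Finset.mem_univ _, hM'.symm⟩)
    · have hdis := hLP j (g' '' K) ⟨⟨i', g', hg', rfl⟩, hS⟩
      rw [IsReplica.eq_closure_interior hK ⟨g', rfl⟩] at hy₀
      exact (hdis.closure_right isOpen_interior).le_bot ⟨hy₀L, hy₀⟩
  obtain ⟨M, hM, hMB, hMm⟩ := ((eventually_all.2 hmeet).and (hB.and
    ((eventually_gt_atTop m).filter_mono Nat.hyperfilter_le_atTop))).exists
  refine hG M m hMm ⟨D M, k, T, ?_, ?_, hT, hTball, fun j j' hjj' => ?_, hM⟩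
  · have h1 : (D M).card ≤ k - 1 := by
      rw [← hScard, ← Nat.card_coe_set_eq, Nat.card_eq_fintype_card]
      exact Finset.card_image_le
    omega
  · intro i' hi'
    obtain ⟨A, -, rfl⟩ := Finset.mem_image.1 hi'
    rintro _ ⟨z, hz, rfl⟩
    have h1 := dist_triangle (G M (i A M) z) (G M (i A M) 0) 0
    rw [(G M (i A M)).dist_eq, dist_zero_right (G M (i A M) 0)] at h1
    rw [mem_closedBall]
    linarith [hMB A, mem_closedBall.1 (hb hz), (le_max_right B' (B + b)).trans hm]
  · exact (hLd j j' hjj').mono (interior_mono ((hTL j).trans interior_subset))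
      (interior_mono ((hTL j').trans interior_subset))

theorem isCovering_limitReplicas (hn : ∀ M, 0 < n M) (hK : IsCompact K)
    (hcov : ∀ M : ℕ, closedBall 0 M ⊆ ⋃ i, G M i '' K) (hU : (U : Filter ℕ) ≤ atTop) :
    IsCovering K (limitReplicas K U G) := by
  refine ⟨fun L hL => isReplica_of_mem_limitReplicas hL, eq_univ_of_forall fun x => ?_⟩
  obtain ⟨m, hm⟩ := exists_nat_ge ‖x‖
  obtain ⟨i, g, y, y₀, hg, hy, hy₀, hp⟩ := exists_limit_of_eventually_exists (K := K) (G := G)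
    (U := U) hn hK (B := ‖x‖) (p := fun M i y => y = x)
    (((eventually_ge_atTop m).filter_mono hU).mono fun M hM => by
      have hx : x ∈ closedBall (0 : Euc d) M := by
        rw [mem_closedBall, dist_zero_right]
        exact hm.trans (Nat.cast_le.2 hM)
      obtain ⟨i, hi⟩ := mem_iUnion.1 (hcov M hx)
      exact ⟨i, x, hi, by simp, rfl⟩)
  obtain rfl : y₀ = x := tendsto_nhds_unique hy
    (tendsto_const_nhds.congr' (hp.mono fun M hM => hM.symm))
  exact ⟨_, ⟨i, g, hg, rfl⟩, hy₀⟩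

theorem IsReplica.dist_le {Q : Set (Euc d)} {s b : ℝ} (hs : 0 ≤ s) (hb : K ⊆ closedBall 0 b)
    (hQ : IsReplica (s • K) Q) {x y : Euc d} (hx : x ∈ Q) (hy : y ∈ Q) :
    dist x y ≤ s * (2 * b) := by
  obtain ⟨f, rfl⟩ := hQ
  obtain ⟨_, ⟨x, hx, rfl⟩, rfl⟩ := hx
  obtain ⟨_, ⟨y, hy, rfl⟩, rfl⟩ := hy
  simp only [f.dist_eq, dist_smul₀, Real.norm_of_nonneg hs]
  gcongr
  linarith [dist_triangle_right x y 0, mem_closedBall.1 (hb hx), mem_closedBall.1 (hb hy)]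

theorem exists_isCompletelyReduced (hK : IsBody K) (hsim : StrictNestedSimilarity K) :
    ∃ C : Set (Set (Euc d)), IsCovering K C ∧ IsCompletelyReduced K C := by
  classical
  obtain ⟨s, Q, hs, hQ, H⟩ := exists_irreducible_coverings hK hsim
  choose n hn G hcov hG using H
  let U : Ultrafilter ℕ := hyperfilter ℕ
  have hU : (U : Filter ℕ) ≤ atTop := Nat.hyperfilter_le_atTop
  refine ⟨limitReplicas K U G, isCovering_limitReplicas hn hK.2.1 hcov hU, fun k hk => ?_⟩
  rintro ⟨S, L, hSC, hSfin, hScard, hL, hLC⟩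
  have := hSfin.fintype
  choose i g hg hgS using fun A : S => hSC A.2
  obtain ⟨B, hB⟩ := exists_forall_eventually_norm_le (U := U) hg
  obtain ⟨b, hb⟩ := hK.2.1.isBounded.subset_closedBall (0 : Euc d)
  have hb0 : 0 ≤ b := by
    obtain ⟨z, hz⟩ := hK.1
    exact dist_nonneg.trans (hb hz)
  obtain ⟨m, hm⟩ := exists_nat_ge (B + 5 * b)
  choose f hf using hL
  let D : ∀ M, Finset (Fin (n M)) := fun M => Finset.univ.image fun A : S => i A M
  let T : Fin (k - 1) → Set (Euc d) := fun j => f j '' Q m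
  have hKQ : K ⊆ Q m := (hQ m).2.trans interior_subset
  have hQb : Q m ⊆ closedBall 0 (5 * b) := fun z hz => by
    obtain ⟨w, hw⟩ := hK.1
    have h1 := (hQ m).1.dist_le (by linarith [(hs m).1]) hb hz (hKQ hw)
    rw [mem_closedBall]
    nlinarith [dist_triangle z w 0, mem_closedBall.1 (hb hw), (hs m).2]
  have hcard : ∀ᶠ M in (U : Filter ℕ), (D M).card = k := by
    have hinj : ∀ᶠ M in (U : Filter ℕ), ∀ A A' : S, A ≠ A' → i A M ≠ i A' M := by
      refine eventually_all.2 fun A => eventually_all.2 fun A' => ?_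
      rw [eventually_imp_distrib_left]
      refine fun hne => Ultrafilter.eventually_not.2 fun h => hne ?_
      rw [Subtype.ext_iff, ← hgS A, ← hgS A', isometryEquiv_limit_unique (hg A) (hg A') h]
    refine hinj.mono fun M hM => ?_
    rw [Finset.card_image_of_injective _ fun A A' h => not_imp_not.1 (hM A A') h,
      ← hScard, ← Nat.card_coe_set_eq, Nat.card_eq_fintype_card, Finset.card_univ]
  have hcover : ∀ᶠ M in (U : Filter ℕ), ∀ y ∈ closedBall (0 : Euc d) (m + 1),
      y ∈ (⋃ j, T j) ∪ ⋃ i' ∉ D M, G M i' '' Q m := by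
    by_contra hcon
    rw [← Ultrafilter.eventually_not] at hcon
    push Not at hcon
    obtain ⟨y, hy⟩ := hcon.choice
    obtain ⟨y₀, hy₀⟩ := exists_tendsto_of_eventually_mem_closedBall (hy.mono fun M hM => hM.1)
    obtain ⟨A, ⟨⟨i', g', hg', rfl⟩, hAS⟩, hyA⟩ | h := hLC.ge (mem_univ y₀)
    · have h1 := eventually_mem_image hg' hy₀ isOpen_interior (image_mono (hQ m).2 hyA)
      have h2 : ∀ᶠ M in (U : Filter ℕ), ∀ A : S, i A M ≠ i' M :=
        eventually_all.2 fun A => Ultrafilter.eventually_not.2 fun h => hAS (by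
          rw [← isometryEquiv_limit_unique (hg A) hg' h, hgS]
          exact A.2)
      obtain ⟨M, hM, hM1, hM2⟩ := (hy.and (h1.and h2)).exists
      refine hM.2 (.inr ?_)
      simp only [mem_iUnion]
      refine ⟨i' M, fun hD => ?_, image_mono interior_subset hM1⟩
      obtain ⟨A, -, hA⟩ := Finset.mem_image.1 hD
      exact hM2 A hA
    · obtain ⟨j, hj⟩ := mem_iUnion.1 h
      have h1 : T j ∈ 𝓝 y₀ := by
        rw [← mem_interior_iff_mem_nhds, interior_image_isometryEquiv]
        rw [← hf j] at hj
        exact image_mono (hQ m).2 hj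
      obtain ⟨M, hM, hM1⟩ := (hy.and (hy₀.eventually h1)).exists
      exact hM.2 (.inl (mem_iUnion.2 ⟨j, hM1⟩))
  obtain ⟨M, hMcard, hMcov, hMB, hMm⟩ := (hcard.and (hcover.and (hB.and
    ((eventually_gt_atTop m).filter_mono hU)))).exists
  have hball : ∀ i' ∈ D M, G M i' '' Q m ⊆ closedBall 0 (m + 1) := by
    intro i' hi'
    obtain ⟨A, -, rfl⟩ := Finset.mem_image.1 hi'
    rintro _ ⟨z, hz, rfl⟩
    have h1 := dist_triangle (G M (i A M) z) (G M (i A M) 0) 0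
    rw [(G M (i A M)).dist_eq, dist_zero_right (G M (i A M) 0)] at h1
    rw [mem_closedBall]
    linarith [hMB A, mem_closedBall.1 (hQb hz)]
  exact hG M m hMm ⟨D M, k - 1, T, by omega, hball, fun j => ⟨f j, rfl⟩,
    fun i' hi' y hy => hMcov y (hball i' hi' (image_mono hKQ hy))⟩

end Limits

/-- A body `K` in `Euc d` with the strict nested similarity property admits a completely
saturated packing and a completely reduced covering of `Euc d` with replicas of `K`. -/
theorem exists_completely_saturated_and_reduced_of_nested_similarity
    (d : ℕ) (K : Set (Euc d)) (hK : IsBody K) (hsim : StrictNestedSimilarity K) :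
    (∃ P : Set (Set (Euc d)), IsPacking K P ∧ IsCompletelySaturated K P) ∧
    (∃ C : Set (Set (Euc d)), IsCovering K C ∧ IsCompletelyReduced K C) :=
  ⟨exists_isCompletelySaturated hK hsim, exists_isCompletelyReduced hK hsim⟩
end
end
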